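/- Let d ≥ 1, let (p₀,q₀) and (p₁,q₁) be two admissible pairs with p₀, p₁ ∈ [2,∞) and q₀, q₁ ∈ [2,∞), and let T > 0. Then there exists a constant C > 0 such that for every continuous map u : [0,T] → 𝒮(ℝ^d;ℂ) one has ‖𝔗u‖_{L^{q₀}(0,T;L^{p₀})} ≤ C · ‖u‖_{L^{q₁'}(0,T;L^{p₁'})}, where r' denotes the conjugate exponent of r. -/

import Mathlib

open MeasureTheory Real Complex
open scoped ENNReal

/-- The free Schrödinger propagator `T(t)` (with `T(0) = id`), given by its
kernel formula for `t ≠ 0`, with the principal branch of the complex power. -/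
noncomputable def schrodingerProp (d : ℕ) (t : ℝ)
    (φ : EuclideanSpace ℝ (Fin d) → ℂ) (x : EuclideanSpace ℝ (Fin d)) : ℂ :=
  if t = 0 then φ x else
    (4 * Real.pi * Complex.I * t) ^ (-(d : ℂ) / 2) *
      ∫ y : EuclideanSpace ℝ (Fin d),
        Complex.exp (Complex.I * ((‖x - y‖ : ℝ) ^ 2 : ℝ) / (4 * t)) * φ y

/-- A pair `(p, q)` of (finite, real) exponents is admissible for dimension `d`:
`2/q = d/2 − d/p`, `2 ≤ p`, and `p < 2d/(d−2)` when `d ≥ 3`. -/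
def IsAdmissible (d : ℕ) (p q : ℝ) : Prop :=
  2 / q = (d : ℝ) / 2 - (d : ℝ) / p ∧ 2 ≤ p ∧ (3 ≤ d → p < 2 * d / ((d : ℝ) - 2))

/-- The convolution operator `𝔗u(t) = ∫₀ᵗ T(t−s) u(s) ds`, computed pointwise. -/
noncomputable def schrodConv (d : ℕ) (u : ℝ → EuclideanSpace ℝ (Fin d) → ℂ)
    (t : ℝ) (x : EuclideanSpace ℝ (Fin d)) : ℂ :=
  ∫ s in (0 : ℝ)..t, schrodingerProp d (t - s) (u s) x

/-- The mixed norm `‖v‖_{L^q(0,T;L^p)} = (∫₀ᵀ ‖v(t)‖_{L^p}^q dt)^{1/q}`. -/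
noncomputable def mixedNorm (d : ℕ) (q p T : ℝ)
    (v : ℝ → EuclideanSpace ℝ (Fin d) → ℂ) : ℝ≥0∞ :=
  (∫⁻ t in Set.Ioc (0 : ℝ) T, (eLpNorm (v t) (ENNReal.ofReal p) volume) ^ q) ^ (1 / q)

namespace Stz

lemma lint_Ioc_rpow {a m : ℝ} (ha : -1 < a) (hm : 0 ≤ m) :
    ∫⁻ μ in Set.Ioc 0 m, ENNReal.ofReal (μ ^ a) = ENNReal.ofReal (m ^ (a + 1) / (a + 1)) := by
  rw [← ofReal_integral_eq_lintegral_ofReal]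
  · rw [← intervalIntegral.integral_of_le hm, integral_rpow (Or.inl ha)]
    rw [Real.zero_rpow (by linarith)]; simp
  · have := intervalIntegral.intervalIntegrable_rpow' (a := 0) (b := m) ha
    rwa [intervalIntegrable_iff_integrableOn_Ioc_of_le hm] at this
  · refine (ae_restrict_mem measurableSet_Ioc).mono fun x hx => Real.rpow_nonneg hx.1.le _

lemma lint_Ioi_rpow {a m : ℝ} (ha : a < -1) (hm : 0 < m) :
    ∫⁻ μ in Set.Ioi m, ENNReal.ofReal (μ ^ a) = ENNReal.ofReal (-m ^ (a + 1) / (a + 1)) := by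
  rw [← ofReal_integral_eq_lintegral_ofReal]
  · rw [integral_Ioi_rpow_of_lt ha hm]
  · exact integrableOn_Ioi_rpow_of_lt ha hm
  · refine (ae_restrict_mem measurableSet_Ioi).mono fun x hx => Real.rpow_nonneg (hm.trans hx).le _

lemma rpow_eq_lint {p : ℝ} (hp : 0 < p) (G : ℝ≥0∞) :
    G ^ p = ∫⁻ μ in Set.Ioi (0:ℝ),
      ENNReal.ofReal (p * μ ^ (p - 1)) * (if ENNReal.ofReal μ < G then 1 else 0) := by
  have key : ∀ m : ℝ, 0 ≤ m → ∫⁻ μ in Set.Ioc 0 m, ENNReal.ofReal (p * μ ^ (p - 1))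
      = ENNReal.ofReal (m ^ p) := by
    intro m hm
    simp_rw [ENNReal.ofReal_mul hp.le]
    rw [lintegral_const_mul _ (by fun_prop), lint_Ioc_rpow (by linarith) hm, ← ENNReal.ofReal_mul hp.le]
    congr 1
    rw [sub_add_cancel]; field_simp
  rcases eq_or_ne G ⊤ with rfl | hG
  · simp only [ENNReal.top_rpow_of_pos hp, ENNReal.ofReal_lt_top, if_true, mul_one]
    symm
    refine ENNReal.eq_top_of_forall_nnreal_le fun r => ?_
    have h := key ((r:ℝ) ^ (1/p)) (by positivity)
    rw [← Real.rpow_mul (by positivity), one_div_mul_cancel hp.ne', Real.rpow_one] at h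
    simp only [ENNReal.ofReal_coe_nnreal] at h
    rw [← h]
    exact lintegral_mono_set (fun x hx => hx.1)
  · lift G to NNReal using hG
    have h := key G (by positivity)
    rw [← ENNReal.ofReal_coe_nnreal, ENNReal.ofReal_rpow_of_nonneg (by positivity) hp.le, ← h]
    rw [← restrict_Ioo_eq_restrict_Ioc]
    rw [← lintegral_indicator measurableSet_Ioo, ← lintegral_indicator measurableSet_Ioi]
    congr 1; ext μ
    by_cases h0 : 0 < μ
    · by_cases h1 : μ < G
      · rw [Set.indicator_of_mem (show μ ∈ Set.Ioo 0 (G:ℝ) from ⟨h0, h1⟩), Set.indicator_of_mem (show μ ∈ Set.Ioi 0 from h0), if_pos, mul_one]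
        rw [ENNReal.ofReal_lt_ofReal_iff (h0.trans h1)]; exact h1
      · rw [Set.indicator_of_notMem (fun hh => h1 hh.2), Set.indicator_of_mem (show μ ∈ Set.Ioi 0 from h0), if_neg, mul_zero]
        rw [not_lt]; exact ENNReal.ofReal_le_ofReal (not_lt.1 h1)
    · rw [Set.indicator_of_notMem (fun hh => h0 hh.1), Set.indicator_of_notMem (show μ ∉ Set.Ioi 0 from h0)]

lemma layercake {α : Type*} [MeasurableSpace α] (ν : Measure α) [SFinite ν] {p : ℝ} (hp : 0 < p)
    {G : α → ℝ≥0∞} (hG : Measurable G) :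
    ∫⁻ x, G x ^ p ∂ν = ∫⁻ μ in Set.Ioi (0:ℝ), ENNReal.ofReal (p * μ ^ (p - 1)) *
      ν {x | ENNReal.ofReal μ < G x} := by
  simp_rw [rpow_eq_lint hp]
  rw [lintegral_lintegral_swap]
  · congr 1; ext μ
    rw [lintegral_const_mul']
    · congr 1
      rw [← lintegral_indicator_one (measurableSet_lt measurable_const hG)]
      congr 1; ext a; simp [Set.indicator_apply]
    · exact ENNReal.ofReal_ne_top
  · apply Measurable.aemeasurable
    apply Measurable.mul
    · fun_prop
    · exact Measurable.ite (measurableSet_lt (by fun_prop) (by fun_prop)) measurable_const measurable_const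

/-- weak to strong, key real interpolation lemma. -/
lemma weak_to_strong {α : Type*} [MeasurableSpace α] (ν : Measure α) [SFinite ν] {p : ℝ} (hp : 2 < p)
    {G : α → ℝ≥0∞} (hG : Measurable G) {F : α → ℝ} (hF : Measurable F) (hF0 : ∀ x, 0 ≤ F x)
    {B : ℝ} (hB : 0 < B)
    (h : ∀ μ : ℝ, 0 < μ → ν {x | ENNReal.ofReal μ < G x} ≤
      ENNReal.ofReal (4 * μ ^ (-2 : ℝ)) * ∫⁻ x, (if F x ≤ (B / μ) ^ (p - 1) then ENNReal.ofReal (F x ^ 2) else 0) ∂ν) :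
    ∫⁻ x, G x ^ p ∂ν ≤ ENNReal.ofReal (4 * p / (p - 2) * B ^ (p - 2)) *
      ∫⁻ x, ENNReal.ofReal (F x ^ (p / (p - 1))) ∂ν := by
  rw [layercake ν (by linarith) hG]
  calc _ ≤ ∫⁻ μ in Set.Ioi (0:ℝ), ∫⁻ x, ENNReal.ofReal (4 * p * μ ^ (p - 3)) *
          (if F x ≤ (B / μ) ^ (p - 1) then ENNReal.ofReal (F x ^ 2) else 0) ∂ν := by
        refine setLIntegral_mono' measurableSet_Ioi fun μ hμ => ?_
        have hμ : 0 < μ := hμ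
        rw [lintegral_const_mul' _ _ ENNReal.ofReal_ne_top]
        refine (mul_le_mul_right (h μ hμ) _).trans ?_
        rw [← mul_assoc, ← ENNReal.ofReal_mul (by positivity)]
        apply le_of_eq
        congr 2
        rw [show p - 3 = (p - 1) + (-2) by ring, Real.rpow_add hμ]; ring
    _ = ∫⁻ x, (∫⁻ μ in Set.Ioi (0:ℝ), ENNReal.ofReal (4 * p * μ ^ (p - 3)) *
          (if F x ≤ (B / μ) ^ (p - 1) then ENNReal.ofReal (F x ^ 2) else 0)) ∂ν := by
        rw [lintegral_lintegral_swap]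
        apply Measurable.aemeasurable
        apply Measurable.mul
        · fun_prop
        · exact Measurable.ite (measurableSet_le (by fun_prop) (by fun_prop)) (by fun_prop) measurable_const
    _ ≤ ∫⁻ x, ENNReal.ofReal (4 * p / (p - 2) * B ^ (p - 2)) *
          ENNReal.ofReal (F x ^ (p / (p - 1))) ∂ν := by
        apply lintegral_mono
        intro x
        dsimp only
        rcases (hF0 x).eq_or_lt with h0 | h0
        · rw [← h0]; simp
        have hm : 0 ≤ B * F x ^ (-1 / (p - 1)) := by positivity
        calc _ ≤ ∫⁻ μ in Set.Ioi (0:ℝ), (Set.Ioc 0 (B * F x ^ (-1 / (p - 1)))).indicator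
                (fun μ => ENNReal.ofReal (4 * p * F x ^ 2) * ENNReal.ofReal (μ ^ (p - 3))) μ := by
              refine setLIntegral_mono' measurableSet_Ioi fun μ hμ => ?_
              have hμ : 0 < μ := hμ
              split_ifs with hle
              · rw [Set.indicator_of_mem]
                · rw [← ENNReal.ofReal_mul (by positivity), ← ENNReal.ofReal_mul (by positivity)]
                  apply le_of_eq; congr 1; ring
                · refine ⟨hμ, ?_⟩
                  have h1 : F x ^ (1 / (p - 1)) ≤ B / μ := by
                    have := Real.rpow_le_rpow h0.le hle (z := 1 / (p - 1)) (by apply div_nonneg <;> linarith)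
                    rwa [← Real.rpow_mul (by positivity), mul_one_div_cancel (by linarith), Real.rpow_one] at this
                  rw [le_div_iff₀ hμ] at h1
                  rw [neg_div, Real.rpow_neg h0.le, ← div_eq_mul_inv, le_div_iff₀ (by positivity)]
                  linarith
              · simp
          _ ≤ ∫⁻ μ in Set.Ioc 0 (B * F x ^ (-1 / (p - 1))), ENNReal.ofReal (4 * p * F x ^ 2) * ENNReal.ofReal (μ ^ (p - 3)) := by
              rw [← lintegral_indicator measurableSet_Ioc]
              exact setLIntegral_le_lintegral _ _
          _ = _ := by
              rw [lintegral_const_mul _ (by fun_prop), lint_Ioc_rpow (by linarith) hm,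
                ← ENNReal.ofReal_mul (by positivity), ← ENNReal.ofReal_mul]
              · congr 1
                rw [Real.mul_rpow hB.le (by positivity), ← Real.rpow_mul h0.le]
                have e : F x ^ (p / (p - 1)) = F x ^ (2:ℕ) * F x ^ (-1 / (p - 1) * (p - 3 + 1)) := by
                  rw [← Real.rpow_natCast, ← Real.rpow_add h0]
                  congr 1
                  have : p - 1 ≠ 0 := by linarith
                  field_simp; push_cast; ring
                rw [e, show p - 3 + 1 = p - 2 by ring]
                ring
              · have : 0 < p - 2 := by linarith
                positivity
    _ = _ := by
        rw [lintegral_const_mul' _ _ ENNReal.ofReal_ne_top]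

end Stz

namespace Stz

lemma young_two {V : Type*} [NormedAddCommGroup V] [InnerProductSpace ℝ V] [FiniteDimensional ℝ V]
    [MeasurableSpace V] [BorelSpace V] {k f : V → ℝ≥0∞} (hk : Measurable k) (hf : Measurable f) :
    ∫⁻ t, (∫⁻ s, k (t - s) * f s) ^ 2 ≤ (∫⁻ s, k s) ^ 2 * ∫⁻ s, f s ^ 2 := by
  calc _ ≤ ∫⁻ t, (∫⁻ s, k s) * (∫⁻ s, k (t - s) * f s ^ 2) := by
        apply lintegral_mono
        intro t
        dsimp only
        have h := ENNReal.lintegral_mul_norm_pow_le (μ := (volume : Measure V))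
          (f := fun s => k (t - s)) (g := fun s => k (t - s) * f s ^ 2)
          (by fun_prop) (by fun_prop) (p := 1/2) (q := 1/2) (by norm_num) (by norm_num) (by norm_num)
        have e : ∀ s, k (t - s) ^ (1/2:ℝ) * (k (t - s) * f s ^ 2) ^ (1/2:ℝ) = k (t - s) * f s := by
          intro s
          rw [ENNReal.mul_rpow_of_nonneg _ _ (by norm_num), ← mul_assoc, ← ENNReal.rpow_add_of_nonneg _ _ (by norm_num) (by norm_num),
            ← ENNReal.rpow_natCast, ← ENNReal.rpow_mul]
          norm_num
        simp_rw [e] at h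
        rw [lintegral_sub_left_eq_self (μ := volume) k t] at h
        calc _ ≤ ((∫⁻ s, k s) ^ (1/2:ℝ) * (∫⁻ s, k (t - s) * f s ^ 2) ^ (1/2:ℝ)) ^ 2 := by gcongr
          _ = _ := by
            rw [mul_pow, ← ENNReal.rpow_natCast, ← ENNReal.rpow_natCast, ← ENNReal.rpow_mul, ← ENNReal.rpow_mul]
            norm_num
    _ = (∫⁻ s, k s) * ∫⁻ t, (∫⁻ s, k (t - s) * f s ^ 2) := by
        rw [lintegral_const_mul]
        exact Measurable.lintegral_prod_right' (f := fun z : V × V => k (z.1 - z.2) * f z.2 ^ 2) (by fun_prop)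
    _ = _ := by
        rw [lintegral_lintegral_swap (Measurable.aemeasurable (by fun_prop))]
        have e : ∀ s, ∫⁻ t, k (t - s) * f s ^ 2 = (∫⁻ t, k t) * f s ^ 2 := by
          intro s
          rw [lintegral_mul_const _ (by fun_prop), lintegral_sub_right_eq_self (μ := volume) k s]
        simp_rw [e]
        rw [lintegral_const_mul _ (by fun_prop)]
        ring

lemma young_one {k f : ℝ → ℝ≥0∞} (hk : Measurable k) (hf : Measurable f) :
    ∫⁻ t, (∫⁻ s, k (t - s) * f s) = (∫⁻ s, k s) * ∫⁻ s, f s := by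
  rw [lintegral_lintegral_swap (Measurable.aemeasurable (by fun_prop))]
  have e : ∀ s, ∫⁻ t, k (t - s) * f s = (∫⁻ t, k t) * f s := by
    intro s
    rw [lintegral_mul_const _ (by fun_prop), lintegral_sub_right_eq_self (μ := volume) k s]
  simp_rw [e]
  rw [lintegral_const_mul _ (by fun_prop)]

lemma lint_abs (h : ℝ → ℝ≥0∞) : ∫⁻ x : ℝ, h |x| = 2 * ∫⁻ x in Set.Ioi 0, h x := by
  have h1 : ∫⁻ x : ℝ in Set.Ioi 0, h |x| = ∫⁻ x in Set.Ioi 0, h x := by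
    refine setLIntegral_congr_fun measurableSet_Ioi fun x hx => ?_
    simp only [abs_of_pos (show 0 < x from hx)]
  have h2 : ∫⁻ x : ℝ in Set.Iic 0, h |x| = ∫⁻ x in Set.Ioi 0, h x := by
    rw [← h1]
    have := (Measure.measurePreserving_neg (volume : Measure ℝ)).setLIntegral_comp_preimage_emb
      (MeasurableEquiv.neg ℝ).measurableEmbedding (fun x => h |x|) (Set.Ici 0)
    simp only [Set.neg_preimage, Set.neg_Ici, neg_zero, abs_neg] at this
    rw [this, setLIntegral_congr Ioi_ae_eq_Ici]
  rw [← lintegral_add_compl _ (measurableSet_Ioi (a := (0:ℝ))), Set.compl_Ioi, h1, h2, two_mul]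

lemma hls_one {q : ℝ} (hq : 2 < q) : ∃ C : ℝ, 0 < C ∧ ∀ f : ℝ → ℝ, Measurable f → (∀ s, 0 ≤ f s) →
    ∫⁻ s, ENNReal.ofReal (f s ^ (q / (q - 1))) ≤ 1 →
    ∫⁻ t, (∫⁻ s, ENNReal.ofReal (|t - s| ^ (-(2 / q))) * ENNReal.ofReal (f s)) ^ q ≤ ENNReal.ofReal C := by
  have hα1 : 0 < 1 - 2 / q := by rw [sub_pos, div_lt_one (by linarith)]; exact hq
  have hq0 : 0 < q := by linarith
  have hq1 : 0 < q - 1 := by linarith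
  have hq2 : 0 < q - 2 := by linarith
  obtain ⟨D, hD⟩ : ∃ D : ℝ, D = 2 / (1 - 2/q) * (2 * 2 ^ q) ^ (1 - 2/q) := ⟨_, rfl⟩
  have hD0 : 0 < D := by rw [hD]; positivity
  refine ⟨4 * q * D ^ (q / (q - 1)) + 16 * q / (q - 2) * D ^ (q / (q - 1)), by positivity, ?_⟩
  intro f hf hf0 hfN
  -- the weak estimate
  have weak : ∀ μ : ℝ, 0 < μ →
      volume {t | ENNReal.ofReal μ < ∫⁻ s, ENNReal.ofReal (|t - s| ^ (-(2 / q))) * ENNReal.ofReal (f s)}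
      ≤ ENNReal.ofReal (4 * D * μ ^ (1 - q)) * (∫⁻ s, if μ ^ (q - 1) / D < f s then ENNReal.ofReal (f s) else 0)
      + ENNReal.ofReal (16 * D ^ 2 * μ ^ (2 - 2 * q)) *
          (∫⁻ s, if μ ^ (q - 1) / D < f s then 0 else ENNReal.ofReal (f s ^ 2)) := by
    intro μ hμ
    obtain ⟨ρ, hρ⟩ : ∃ ρ : ℝ, ρ = 2 * (2 / μ) ^ q := ⟨_, rfl⟩
    have hρ0 : 0 < ρ := by rw [hρ]; positivity
    obtain ⟨κ, hκ⟩ : ∃ κ : ℝ, κ = D * μ ^ (2 - q) := ⟨_, rfl⟩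
    have hκ0 : 0 < κ := by rw [hκ]; positivity
    obtain ⟨k1, hk1⟩ : ∃ k1 : ℝ → ℝ≥0∞, k1 = fun τ => if |τ| ≤ ρ then ENNReal.ofReal (|τ| ^ (-(2 / q))) else 0 := ⟨_, rfl⟩
    obtain ⟨k2, hk2⟩ : ∃ k2 : ℝ → ℝ≥0∞, k2 = fun τ => if |τ| ≤ ρ then 0 else ENNReal.ofReal (|τ| ^ (-(2 / q))) := ⟨_, rfl⟩
    have hk1m : Measurable k1 := by
      rw [hk1]; exact Measurable.ite (measurableSet_le (by fun_prop) (by fun_prop)) (by fun_prop) measurable_const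
    have hk2m : Measurable k2 := by
      rw [hk2]; exact Measurable.ite (measurableSet_le (by fun_prop) (by fun_prop)) measurable_const (by fun_prop)
    obtain ⟨f1, hf1⟩ : ∃ f1 : ℝ → ℝ≥0∞, f1 = fun s => if μ ^ (q - 1) / D < f s then ENNReal.ofReal (f s) else 0 := ⟨_, rfl⟩
    obtain ⟨f2, hf2⟩ : ∃ f2 : ℝ → ℝ≥0∞, f2 = fun s => if μ ^ (q - 1) / D < f s then 0 else ENNReal.ofReal (f s) := ⟨_, rfl⟩
    have hf1m : Measurable f1 := by
      rw [hf1]; exact Measurable.ite (measurableSet_lt (by fun_prop) (by fun_prop)) (by fun_prop) measurable_const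
    have hf2m : Measurable f2 := by
      rw [hf2]; exact Measurable.ite (measurableSet_lt (by fun_prop) (by fun_prop)) measurable_const (by fun_prop)
    have ik1 : ∫⁻ τ, k1 τ = ENNReal.ofReal κ := by
      rw [hk1, lint_abs (fun x => if x ≤ ρ then ENNReal.ofReal (x ^ (-(2 / q))) else 0)]
      have : ∫⁻ x in Set.Ioi 0, (if x ≤ ρ then ENNReal.ofReal (x ^ (-(2 / q))) else 0)
          = ∫⁻ x in Set.Ioc 0 ρ, ENNReal.ofReal (x ^ (-(2 / q))) := by
        rw [← lintegral_indicator measurableSet_Ioi, ← lintegral_indicator measurableSet_Ioc]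
        congr 1; ext x
        simp only [Set.indicator_apply, Set.mem_Ioi, Set.mem_Ioc]
        split_ifs <;> first | rfl | (exfalso; simp_all; done) | (exfalso; grind)
      rw [this, lint_Ioc_rpow (by linarith) hρ0.le, show (2:ℝ≥0∞) = ENNReal.ofReal 2 by simp,
        ← ENNReal.ofReal_mul (by norm_num)]
      congr 1
      rw [hκ, hD, hρ, Real.div_rpow (by norm_num) hμ.le, ← mul_div_assoc 2 (2 ^ q), Real.div_rpow (by positivity) (by positivity),
        ← Real.rpow_mul hμ.le, show q * (-(2/q) + 1) = -(2 - q) by field_simp; ring, Real.rpow_neg hμ.le,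
        show -(2/q) + 1 = 1 - 2/q by ring]
      field_simp
    have ik2 : ∫⁻ τ, k2 τ ^ q = ENNReal.ofReal (2 / ρ) := by
      have e : ∀ τ, k2 τ ^ q = (fun x => if x ≤ ρ then 0 else ENNReal.ofReal (x ^ (-2:ℝ))) |τ| := by
        intro τ
        rw [hk2]
        dsimp only
        split_ifs with h
        · simp [hq0]
        · rw [ENNReal.ofReal_rpow_of_nonneg (by positivity) hq0.le, ← Real.rpow_mul (by positivity)]
          congr 2
          field_simp
      simp_rw [e]
      rw [lint_abs (fun x => if x ≤ ρ then 0 else ENNReal.ofReal (x ^ (-2:ℝ)))]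
      have : ∫⁻ x in Set.Ioi 0, (if x ≤ ρ then 0 else ENNReal.ofReal (x ^ (-2:ℝ)))
          = ∫⁻ x in Set.Ioi ρ, ENNReal.ofReal (x ^ (-2:ℝ)) := by
        rw [← lintegral_indicator measurableSet_Ioi, ← lintegral_indicator measurableSet_Ioi]
        congr 1; ext x
        simp only [Set.indicator_apply, Set.mem_Ioi]
        split_ifs <;> first | rfl | (exfalso; linarith)
      rw [this, lint_Ioi_rpow (by norm_num) hρ0, show (2:ℝ≥0∞) = ENNReal.ofReal 2 by simp,
        ← ENNReal.ofReal_mul (by norm_num)]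
      congr 1
      norm_num [Real.rpow_neg_one]
      rfl
    have b2 : ∀ t, ∫⁻ s, k2 (t - s) * ENNReal.ofReal (f s) ≤ ENNReal.ofReal (μ / 2) := by
      intro t
      have hc : q.HolderConjugate (q / (q - 1)) := Real.HolderConjugate.conjExponent (by linarith)
      refine (ENNReal.lintegral_mul_le_Lp_mul_Lq volume hc (f := fun s => k2 (t - s))
        (g := fun s => ENNReal.ofReal (f s)) (by fun_prop) (by fun_prop)).trans ?_
      rw [lintegral_sub_left_eq_self (μ := volume) (fun x => k2 x ^ q) t, ik2]
      have : ∫⁻ s, ENNReal.ofReal (f s) ^ (q / (q - 1)) ≤ 1 := by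
        refine le_trans (le_of_eq ?_) hfN
        congr 1; ext s
        rw [ENNReal.ofReal_rpow_of_nonneg (hf0 s) (by positivity)]
      calc _ ≤ ENNReal.ofReal (2 / ρ) ^ (1 / q) * 1 ^ (1 / (q / (q-1))) := by gcongr
        _ = _ := by
          rw [ENNReal.one_rpow, mul_one, ENNReal.ofReal_rpow_of_nonneg (by positivity) (by positivity)]
          congr 1
          rw [hρ, show 2 / (2 * (2 / μ) ^ q) = ((μ / 2)) ^ q by
            rw [Real.div_rpow (by positivity) (by positivity), Real.div_rpow (by positivity) (by positivity)]; field_simp]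
          rw [← Real.rpow_mul (by positivity), mul_one_div_cancel hq0.ne', Real.rpow_one]
    have split : ∀ t, ∫⁻ s, ENNReal.ofReal (|t - s| ^ (-(2 / q))) * ENNReal.ofReal (f s)
        = (∫⁻ s, k1 (t - s) * f1 s) + (∫⁻ s, k1 (t - s) * f2 s) + ∫⁻ s, k2 (t - s) * ENNReal.ofReal (f s) := by
      intro t
      rw [← lintegral_add_left (by fun_prop), ← lintegral_add_left (by fun_prop)]
      congr 1; ext s
      rw [hk1, hk2, hf1, hf2]; dsimp only
      split_ifs <;> simp
    have sub : {t | ENNReal.ofReal μ < ∫⁻ s, ENNReal.ofReal (|t - s| ^ (-(2 / q))) * ENNReal.ofReal (f s)} ⊆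
        {t | ENNReal.ofReal (μ / 4) ≤ ∫⁻ s, k1 (t - s) * f1 s} ∪
        {t | ENNReal.ofReal (μ ^ 2 / 16) ≤ (∫⁻ s, k1 (t - s) * f2 s) ^ 2} := by
      intro t ht
      by_contra hcon
      simp only [Set.mem_union, Set.mem_ofPred_eq, not_or, not_le] at hcon ht
      obtain ⟨h1, h2⟩ := hcon
      have h3 : (∫⁻ s, k1 (t - s) * f2 s) ≤ ENNReal.ofReal (μ / 4) := by
        by_contra h4
        rw [not_le] at h4
        have := pow_le_pow_left₀ (zero_le) h4.le 2
        rw [← ENNReal.ofReal_pow (by positivity)] at this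
        apply absurd (h2.trans_le' this)
        rw [not_lt]; apply ENNReal.ofReal_le_ofReal; linarith
      rw [split t] at ht
      have := add_le_add (add_le_add h1.le h3) (b2 t)
      rw [← ENNReal.ofReal_add (by positivity) (by positivity), ← ENNReal.ofReal_add (by positivity) (by positivity)] at this
      apply absurd (ht.trans_le this)
      rw [not_lt]; apply ENNReal.ofReal_le_ofReal; linarith
    refine (measure_mono sub).trans ((measure_union_le _ _).trans (add_le_add ?_ ?_))
    · have m1 : Measurable fun t => ∫⁻ s, k1 (t - s) * f1 s :=
        Measurable.lintegral_prod_right' (f := fun z : ℝ × ℝ => k1 (z.1 - z.2) * f1 z.2) (by fun_prop)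
      refine (meas_ge_le_lintegral_div m1.aemeasurable (by simp [hμ]) (by simp)).trans ?_
      rw [young_one hk1m hf1m, ik1, hf1, div_eq_mul_inv, ← ENNReal.ofReal_inv_of_pos (by positivity), mul_right_comm,
        ← ENNReal.ofReal_mul (by positivity)]
      apply le_of_eq; congr 2
      rw [hκ, show 1 - q = (2 - q) - 1 by ring, Real.rpow_sub_one hμ.ne']
      field_simp
    · have m2 : Measurable fun t => ∫⁻ s, k1 (t - s) * f2 s :=
        Measurable.lintegral_prod_right' (f := fun z : ℝ × ℝ => k1 (z.1 - z.2) * f2 z.2) (by fun_prop)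
      refine (meas_ge_le_lintegral_div (by fun_prop) (by simp; positivity) (by simp)).trans ?_
      refine (ENNReal.div_le_div_right (young_two hk1m hf2m) _).trans ?_
      have : ∫⁻ s, f2 s ^ 2 = ∫⁻ s, if μ ^ (q - 1) / D < f s then 0 else ENNReal.ofReal (f s ^ 2) := by
        congr 1; ext s
        rw [hf2]; dsimp only
        split_ifs
        · simp
        · rw [ENNReal.ofReal_pow (hf0 s)]
      rw [this, ik1, div_eq_mul_inv, ← ENNReal.ofReal_inv_of_pos (by positivity), mul_right_comm,
        ← ENNReal.ofReal_pow hκ0.le, ← ENNReal.ofReal_mul (by positivity)]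
      apply le_of_eq; congr 2
      have e : μ ^ (2 - 2 * q) = (μ ^ (2 - q)) ^ 2 / μ ^ 2 := by
        rw [← Real.rpow_natCast, ← Real.rpow_mul hμ.le, ← Real.rpow_natCast, ← Real.rpow_sub hμ]
        congr 1; push_cast; ring
      rw [hκ, e]
      field_simp
  -- integrate
  have mI : Measurable fun t => ∫⁻ s, ENNReal.ofReal (|t - s| ^ (-(2 / q))) * ENNReal.ofReal (f s) :=
    Measurable.lintegral_prod_right' (f := fun z : ℝ × ℝ => ENNReal.ofReal (|z.1 - z.2| ^ (-(2 / q))) * ENNReal.ofReal (f z.2))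
      (by fun_prop)
  rw [layercake volume hq0 mI]
  have meas1 : Measurable fun z : ℝ × ℝ => if z.1 ^ (q - 1) / D < f z.2 then ENNReal.ofReal (f z.2) else 0 :=
    Measurable.ite (measurableSet_lt (by fun_prop) (by fun_prop)) (by fun_prop) measurable_const
  have meas2 : Measurable fun z : ℝ × ℝ => if z.1 ^ (q - 1) / D < f z.2 then 0 else ENNReal.ofReal (f z.2 ^ 2) :=
    Measurable.ite (measurableSet_lt (by fun_prop) (by fun_prop)) measurable_const (by fun_prop)
  have pos_of : ∀ s, 0 < f s → 0 < D * f s := fun s h => by positivity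
  calc _ ≤ ∫⁻ μ in Set.Ioi (0:ℝ), ((∫⁻ s, ENNReal.ofReal (4 * q * D) * (if μ ^ (q - 1) / D < f s then ENNReal.ofReal (f s) else 0))
          + ∫⁻ s, ENNReal.ofReal (16 * q * D ^ 2 * μ ^ (1 - q)) * (if μ ^ (q - 1) / D < f s then 0 else ENNReal.ofReal (f s ^ 2))) := by
        refine setLIntegral_mono' measurableSet_Ioi fun μ hμ => ?_
        have hμ : 0 < μ := hμ
        rw [lintegral_const_mul' _ _ ENNReal.ofReal_ne_top, lintegral_const_mul' _ _ ENNReal.ofReal_ne_top]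
        refine (mul_le_mul_right (weak μ hμ) _).trans ?_
        rw [mul_add, ← mul_assoc, ← mul_assoc, ← ENNReal.ofReal_mul (by positivity), ← ENNReal.ofReal_mul (by positivity)]
        apply le_of_eq
        congr 3
        · rw [show 1 - q = -(q - 1) by ring, Real.rpow_neg hμ.le]
          field_simp
        · rw [show 2 - 2 * q = (1 - q) + (1 - q) by ring, Real.rpow_add hμ, show 1 - q = -(q - 1) by ring, Real.rpow_neg hμ.le]
          field_simp
    _ = (∫⁻ s, ∫⁻ μ in Set.Ioi (0:ℝ), ENNReal.ofReal (4 * q * D) * (if μ ^ (q - 1) / D < f s then ENNReal.ofReal (f s) else 0))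
          + ∫⁻ s, ∫⁻ μ in Set.Ioi (0:ℝ), ENNReal.ofReal (16 * q * D ^ 2 * μ ^ (1 - q)) * (if μ ^ (q - 1) / D < f s then 0 else ENNReal.ofReal (f s ^ 2)) := by
        rw [lintegral_add_left]
        · congr 1
          · refine lintegral_lintegral_swap ?_
            exact Measurable.aemeasurable (Measurable.mul (by fun_prop) meas1)
          · refine lintegral_lintegral_swap ?_
            exact Measurable.aemeasurable (Measurable.mul (by fun_prop) meas2)
        · exact Measurable.lintegral_prod_right' (f := fun z : ℝ × ℝ => ENNReal.ofReal (4 * q * D) * (if z.1 ^ (q - 1) / D < f z.2 then ENNReal.ofReal (f z.2) else 0))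
            (Measurable.mul (by fun_prop) meas1)
    _ ≤ (∫⁻ s, ENNReal.ofReal (4 * q * D ^ (q / (q - 1))) * ENNReal.ofReal (f s ^ (q / (q - 1))))
          + ∫⁻ s, ENNReal.ofReal (16 * q / (q - 2) * D ^ (q / (q - 1))) * ENNReal.ofReal (f s ^ (q / (q - 1))) := by
        refine add_le_add (lintegral_mono fun s => ?_) (lintegral_mono fun s => ?_)
        · dsimp only
          rcases (hf0 s).eq_or_lt with h0 | h0
          · rw [← h0]; simp
          have hm : 0 ≤ (D * f s) ^ (1 / (q - 1)) := by positivity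
          calc _ ≤ ∫⁻ μ in Set.Ioi (0:ℝ), (Set.Ioc 0 ((D * f s) ^ (1 / (q - 1)))).indicator
                (fun μ => ENNReal.ofReal (4 * q * D * f s)) μ := by
                refine setLIntegral_mono' measurableSet_Ioi fun μ hμ => ?_
                have hμ : 0 < μ := hμ
                split_ifs with hle
                · rw [Set.indicator_of_mem, ← ENNReal.ofReal_mul (by positivity)]
                  refine ⟨hμ, ?_⟩
                  rw [div_lt_iff₀ hD0] at hle
                  rw [one_div, Real.le_rpow_inv_iff_of_pos hμ.le (by positivity) hq1]
                  linarith
                · simp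
            _ ≤ ∫⁻ μ in Set.Ioc 0 ((D * f s) ^ (1 / (q - 1))), ENNReal.ofReal (4 * q * D * f s) := by
                rw [← lintegral_indicator measurableSet_Ioc]
                exact setLIntegral_le_lintegral _ _
            _ = _ := by
                rw [setLIntegral_const, Real.volume_Ioc, ← ENNReal.ofReal_mul (by positivity), ← ENNReal.ofReal_mul (by positivity)]
                congr 1
                rw [sub_zero, Real.mul_rpow hD0.le h0.le, show q / (q - 1) = 1 + 1 / (q - 1) by field_simp; ring,
                  Real.rpow_add hD0, Real.rpow_add h0, Real.rpow_one, Real.rpow_one]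
                ring
        · dsimp only
          rcases (hf0 s).eq_or_lt with h0 | h0
          · rw [← h0]; simp
          have hm : 0 < (D * f s) ^ (1 / (q - 1)) := by positivity
          calc _ ≤ ∫⁻ μ in Set.Ioi (0:ℝ), (Set.Ici ((D * f s) ^ (1 / (q - 1)))).indicator
                (fun μ => ENNReal.ofReal (16 * q * D ^ 2 * f s ^ 2) * ENNReal.ofReal (μ ^ (1 - q))) μ := by
                refine setLIntegral_mono' measurableSet_Ioi fun μ hμ => ?_
                have hμ : 0 < μ := hμ
                split_ifs with hle
                · simp
                · rw [Set.indicator_of_mem, ← ENNReal.ofReal_mul (by positivity), ← ENNReal.ofReal_mul (by positivity)]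
                  · apply le_of_eq; congr 1; ring
                  rw [not_lt, le_div_iff₀ hD0] at hle
                  rw [Set.mem_Ici, one_div, Real.rpow_inv_le_iff_of_pos (by positivity) hμ.le hq1]
                  linarith
            _ ≤ ∫⁻ μ in Set.Ici ((D * f s) ^ (1 / (q - 1))), ENNReal.ofReal (16 * q * D ^ 2 * f s ^ 2) * ENNReal.ofReal (μ ^ (1 - q)) := by
                rw [← lintegral_indicator measurableSet_Ici]
                exact setLIntegral_le_lintegral _ _
            _ = _ := by
                rw [setLIntegral_congr Ioi_ae_eq_Ici.symm, lintegral_const_mul' _ _ ENNReal.ofReal_ne_top, lint_Ioi_rpow (by linarith) hm,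
                  ← ENNReal.ofReal_mul (by positivity), ← ENNReal.ofReal_mul (by positivity)]
                congr 1
                have hz : ∀ z : ℝ, 0 < z → z ^ (q / (q - 1)) = z ^ 2 * (z ^ (1 / (q - 1))) ^ (1 - q + 1) := by
                  intro z hz
                  rw [← Real.rpow_mul hz.le, ← Real.rpow_natCast, ← Real.rpow_add hz]
                  congr 1; push_cast; field_simp; ring
                have := hz (D * f s) (by positivity)
                rw [mul_assoc (16 * q / (q - 2)), ← Real.mul_rpow hD0.le h0.le, this, show 1 - q + 1 = -(q - 2) by ring]
                field_simp
    _ ≤ _ := by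
        rw [lintegral_const_mul' _ _ ENNReal.ofReal_ne_top, lintegral_const_mul' _ _ ENNReal.ofReal_ne_top, ← add_mul,
          ← ENNReal.ofReal_add (by positivity) (by positivity)]
        exact mul_le_of_le_one_right zero_le hfN

end Stz

namespace Stz

lemma hls_norm {q : ℝ} (hq : 2 < q) : ∃ C : ℝ, 0 < C ∧ ∀ φ : ℝ → ℝ≥0∞, Measurable φ →
    (∫⁻ t, (∫⁻ s, ENNReal.ofReal (|t - s| ^ (-(2 / q))) * φ s) ^ q) ^ (1 / q) ≤
      ENNReal.ofReal C * (∫⁻ s, φ s ^ (q / (q - 1))) ^ (1 / (q / (q - 1))) := by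
  have hq0 : 0 < q := by linarith
  have hq1 : 0 < q - 1 := by linarith
  have hr : 0 < q / (q - 1) := by positivity
  obtain ⟨C, hC, h⟩ := hls_one hq
  refine ⟨C ^ (1 / q), by positivity, fun φ hφ => ?_⟩
  obtain ⟨r, hrr⟩ : ∃ r, r = q / (q - 1) := ⟨_, rfl⟩
  rw [← hrr] at hr h ⊢
  obtain ⟨N, hN⟩ : ∃ N, N = ∫⁻ s, φ s ^ r := ⟨_, rfl⟩
  rw [← hN]
  by_cases h0 : N = 0
  · have hz : ∀ᵐ s, φ s = 0 := by
      rw [h0, eq_comm, lintegral_eq_zero_iff (by fun_prop)] at hN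
      filter_upwards [hN] with s hs
      simpa [hr, hr.not_gt] using hs
    have : ∀ t, ∫⁻ s, ENNReal.ofReal (|t - s| ^ (-(2 / q))) * φ s = 0 := by
      intro t
      rw [lintegral_eq_zero_iff (by fun_prop)]
      filter_upwards [hz] with s hs
      simp [hs]
    simp_rw [this]
    simp [hq0]
  by_cases htop : N = ⊤
  · rw [htop, ENNReal.top_rpow_of_pos (by positivity), ENNReal.mul_top]
    · exact le_top
    · simp; positivity
  obtain ⟨M, hM⟩ : ∃ M, M = N ^ (1 / r) := ⟨_, rfl⟩
  have hM0 : M ≠ 0 := by rw [hM]; simp [h0, hr.le, htop]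
  have hMt : M ≠ ⊤ := by rw [hM]; exact ENNReal.rpow_ne_top_of_nonneg (by positivity) htop
  have hfin : ∀ᵐ s, φ s < ⊤ := by
    have : ∀ᵐ s, φ s ^ r < ⊤ := ae_lt_top (by fun_prop) (by rw [← hN]; exact htop)
    filter_upwards [this] with s hs
    by_contra hcon
    rw [not_lt, top_le_iff] at hcon
    rw [hcon, ENNReal.top_rpow_of_pos hr] at hs
    exact lt_irrefl _ hs
  have hM0' : 0 < M.toReal := ENNReal.toReal_pos hM0 hMt
  have key := h (fun s => (φ s).toReal / M.toReal) (by fun_prop) (fun s => by positivity) ?_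
  · have e : ∀ t, ∫⁻ s, ENNReal.ofReal (|t - s| ^ (-(2 / q))) * φ s =
        M * ∫⁻ s, ENNReal.ofReal (|t - s| ^ (-(2 / q))) * ENNReal.ofReal ((φ s).toReal / M.toReal) := by
      intro t
      rw [← lintegral_const_mul' _ _ hMt]
      apply lintegral_congr_ae
      filter_upwards [hfin] with s hs
      rw [ENNReal.ofReal_div_of_pos hM0', ENNReal.ofReal_toReal hs.ne, ENNReal.ofReal_toReal hMt, mul_left_comm,
        ENNReal.mul_div_cancel hM0 hMt]
    simp_rw [e, ENNReal.mul_rpow_of_nonneg _ _ hq0.le]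
    rw [lintegral_const_mul' _ _ (ENNReal.rpow_ne_top_of_nonneg hq0.le hMt), ENNReal.mul_rpow_of_nonneg _ _ (by positivity),
      ← ENNReal.rpow_mul, mul_one_div_cancel hq0.ne', ENNReal.rpow_one, ← hM, mul_comm]
    gcongr
    rw [← ENNReal.ofReal_rpow_of_pos hC]
    gcongr
  · apply le_of_eq
    have e : ∀ᵐ s, ENNReal.ofReal (((φ s).toReal / M.toReal) ^ r) = N⁻¹ * φ s ^ r := by
      filter_upwards [hfin] with s hs
      rw [← ENNReal.ofReal_rpow_of_nonneg (by positivity) hr.le, ENNReal.ofReal_div_of_pos hM0', ENNReal.ofReal_toReal hs.ne, ENNReal.ofReal_toReal hMt,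
        ENNReal.div_rpow_of_nonneg _ _ hr.le, hM, ← ENNReal.rpow_mul, one_div_mul_cancel hr.ne', ENNReal.rpow_one, mul_comm]
      rfl
    rw [lintegral_congr_ae e, lintegral_const_mul' _ _ (by simp [h0]), ← hN, ENNReal.inv_mul_cancel h0 htop]

lemma hls {q : ℝ} (hq : 2 < q) : ∃ C : ℝ, 0 < C ∧ ∀ φ ψ : ℝ → ℝ≥0∞, Measurable φ → Measurable ψ →
    ∫⁻ t, ∫⁻ s, ENNReal.ofReal (|t - s| ^ (-(2 / q))) * φ s * ψ t ≤
      ENNReal.ofReal C * (∫⁻ s, φ s ^ (q / (q - 1))) ^ (1 / (q / (q - 1))) *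
        (∫⁻ s, ψ s ^ (q / (q - 1))) ^ (1 / (q / (q - 1))) := by
  obtain ⟨C, hC, h⟩ := hls_norm hq
  refine ⟨C, hC, fun φ ψ hφ hψ => ?_⟩
  have hc : q.HolderConjugate (q / (q - 1)) := Real.HolderConjugate.conjExponent (by linarith)
  have mI : Measurable fun t => ∫⁻ s, ENNReal.ofReal (|t - s| ^ (-(2 / q))) * φ s :=
    Measurable.lintegral_prod_right' (f := fun z : ℝ × ℝ => ENNReal.ofReal (|z.1 - z.2| ^ (-(2 / q))) * φ z.2)
      (by fun_prop)
  calc _ = ∫⁻ t, (∫⁻ s, ENNReal.ofReal (|t - s| ^ (-(2 / q))) * φ s) * ψ t := by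
        congr 1; ext t
        rw [lintegral_mul_const _ (by fun_prop)]
    _ ≤ _ := (ENNReal.lintegral_mul_le_Lp_mul_Lq volume hc mI.aemeasurable hψ.aemeasurable).trans
        (mul_le_mul_left (h φ hφ) _)

variable {V : Type*} [NormedAddCommGroup V] [InnerProductSpace ℝ V] [FiniteDimensional ℝ V]
    [MeasurableSpace V] [BorelSpace V]

/-- measurable, bounded, integrable -/
structure Nice {α : Type*} [MeasureSpace α] (f : α → ℂ) : Prop where
  meas : Measurable f
  bdd : ∃ M : ℝ, ∀ x, ‖f x‖ ≤ M
  int : Integrable f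

lemma Nice.lint_rpow_lt_top {α : Type*} [MeasureSpace α] {f : α → ℂ} (hf : Nice f) {r : ℝ} (hr : 1 ≤ r) :
    ∫⁻ x, ‖f x‖ₑ ^ r < ⊤ := by
  obtain ⟨M, hM⟩ := hf.bdd
  have hM0 : ∀ x, ‖f x‖ₑ ≤ ENNReal.ofReal M := fun x => by
    rw [← ofReal_norm]; exact ENNReal.ofReal_le_ofReal (hM x)
  calc _ ≤ ∫⁻ x, ENNReal.ofReal M ^ (r - 1) * ‖f x‖ₑ := by
        apply lintegral_mono
        intro x
        dsimp only
        calc ‖f x‖ₑ ^ r = ‖f x‖ₑ ^ (r - 1) * ‖f x‖ₑ ^ (1:ℝ) := by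
              rw [← ENNReal.rpow_add_of_nonneg _ _ (by linarith) (by norm_num)]; congr 1; ring
          _ ≤ _ := by
              rw [ENNReal.rpow_one]
              gcongr
              exact hM0 x
    _ < ⊤ := by
        rw [lintegral_const_mul' _ _ (ENNReal.rpow_ne_top_of_nonneg (by linarith) ENNReal.ofReal_ne_top)]
        exact ENNReal.mul_lt_top (ENNReal.rpow_lt_top_of_nonneg (by linarith) ENNReal.ofReal_ne_top) hf.int.2

lemma Nice.indicator {α : Type*} [MeasureSpace α] {f : α → ℂ} (hf : Nice f) {s : Set α} (hs : MeasurableSet s) :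
    Nice (s.indicator f) := by
  obtain ⟨M, hM⟩ := hf.bdd
  exact ⟨hf.meas.indicator hs, ⟨M, fun x => (norm_indicator_le_norm_self _ _).trans (hM x)⟩, hf.int.indicator hs⟩

lemma interp_norm {p : ℝ} (hp : 2 < p) {k : V → V → ℂ} {A : ℝ} (hA : 0 < A)
    (hk : Measurable (Function.uncurry k)) (hkA : ∀ x y, ‖k x y‖ ≤ A)
    (h2 : ∀ f : V → ℂ, Nice f → ∫⁻ x, ‖∫ y, k x y * f y‖ₑ ^ 2 ≤ ∫⁻ x, ‖f x‖ₑ ^ 2)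
    {f : V → ℂ} (hf : Nice f) :
    (∫⁻ x, ‖∫ y, k x y * f y‖ₑ ^ p) ^ (1 / p) ≤
      ENNReal.ofReal ((4 * p / (p - 2) * 2 ^ (p - 2)) ^ (1 / p) * A ^ (1 - 2 / p)) *
        (∫⁻ x, ‖f x‖ₑ ^ (p / (p - 1))) ^ (1 / (p / (p - 1))) := by
  have hp0 : 0 < p := by linarith
  have hp1 : 0 < p - 1 := by linarith
  have hp2 : 0 < p - 2 := by linarith
  have hr1 : 1 < p / (p - 1) := by rw [lt_div_iff₀ hp1]; linarith
  obtain ⟨r, hr⟩ : ∃ r, r = p / (p - 1) := ⟨_, rfl⟩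
  rw [← hr] at hr1 ⊢
  have hr0 : 0 < r := by linarith
  have hNt := hf.lint_rpow_lt_top hr1.le
  have hintg : ∀ g : V → ℂ, Nice g → ∀ x, Integrable (fun y => k x y * g y) := by
    intro g hg x
    refine Integrable.mono' (hg.int.norm.const_mul A) ?_ (Filter.Eventually.of_forall fun y => ?_)
    · exact ((hk.comp measurable_prodMk_left).mul hg.meas).aestronglyMeasurable
    · rw [norm_mul]; gcongr; exact hkA x y
  obtain ⟨N, hN⟩ : ∃ N : ℝ, N = (∫⁻ x, ‖f x‖ₑ ^ r).toReal := ⟨_, rfl⟩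
  have hN' : ∫⁻ x, ‖f x‖ₑ ^ r = ENNReal.ofReal N := by rw [hN, ENNReal.ofReal_toReal hNt.ne]
  have hN0 : 0 ≤ N := by rw [hN]; positivity
  rw [hN']
  rcases hN0.eq_or_lt with h0 | hNpos
  · have hz : f =ᵐ[volume] 0 := by
      rw [← h0, ENNReal.ofReal_zero, lintegral_eq_zero_iff (by have := hf.meas; fun_prop)] at hN'
      filter_upwards [hN'] with s hs
      simpa [hr0, hr0.not_gt] using hs
    have : ∀ x, ∫ y, k x y * f y = 0 := by
      intro x
      rw [integral_eq_zero_of_ae]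
      filter_upwards [hz] with y hy
      simp [hy]
    simp_rw [this]
    simp [hp0]
  have hmf := hf.meas
  have hS : ∀ g : V → ℂ, Nice g → Measurable fun x => ‖∫ y, k x y * g y‖ₑ := by
    intro g hg
    have hmg := hg.meas
    apply Measurable.enorm
    apply StronglyMeasurable.measurable
    exact StronglyMeasurable.integral_prod_right' (f := fun z : V × V => k z.1 z.2 * g z.2)
      (Measurable.stronglyMeasurable (hk.mul (hmg.comp measurable_snd)))
  have key := weak_to_strong volume hp (hS f hf) (F := fun x => ‖f x‖) (by fun_prop) (fun x => norm_nonneg _)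
    (B := 2 * A * N) (by positivity) ?_
  · rw [← hr] at key
    have e : ∫⁻ x, ENNReal.ofReal (‖f x‖ ^ r) = ENNReal.ofReal N := by
      rw [← hN']
      congr 1; ext x
      rw [← ENNReal.ofReal_rpow_of_nonneg (by positivity) hr0.le, ofReal_norm]
    rw [e, ← ENNReal.ofReal_mul (by positivity)] at key
    calc _ ≤ _ := ENNReal.rpow_le_rpow key (by positivity)
      _ = _ := by
        rw [ENNReal.ofReal_rpow_of_nonneg (by positivity) (by positivity), ENNReal.ofReal_rpow_of_nonneg (by positivity) (by positivity),
          ← ENNReal.ofReal_mul (by positivity)]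
        congr 1
        rw [Real.mul_rpow (x := 2 * A) (y := N) (by positivity) (by positivity), Real.mul_rpow (x := 2) (y := A) (by positivity) (by positivity),
          show 4 * p / (p - 2) * (2 ^ (p - 2) * A ^ (p - 2) * N ^ (p - 2)) * N
            = (4 * p / (p - 2) * 2 ^ (p - 2)) * A ^ (p - 2) * (N ^ (p - 2) * N) by ring, ← Real.rpow_add_one hNpos.ne',
          Real.mul_rpow (by positivity) (by positivity), Real.mul_rpow (by positivity) (by positivity),
          ← Real.rpow_mul hA.le, ← Real.rpow_mul hNpos.le]
        congr 2
        · congr 1; field_simp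
        · rw [hr]; field_simp; ring
  · intro μ hμ
    obtain ⟨l, hl⟩ : ∃ l : ℝ, l = (2 * A * N / μ) ^ (p - 1) := ⟨_, rfl⟩
    have hl0 : 0 < l := by rw [hl]; positivity
    rw [← hl]
    have hms : MeasurableSet {x | ‖f x‖ ≤ l} := measurableSet_le (by fun_prop) (by fun_prop)
    obtain ⟨f1, hf1⟩ : ∃ f1, f1 = {x | ‖f x‖ ≤ l}ᶜ.indicator f := ⟨_, rfl⟩
    obtain ⟨f2, hf2⟩ : ∃ f2, f2 = {x | ‖f x‖ ≤ l}.indicator f := ⟨_, rfl⟩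
    have n1 : Nice f1 := by rw [hf1]; exact hf.indicator hms.compl
    have n2 : Nice f2 := by rw [hf2]; exact hf.indicator hms
    have b1 : ∀ x, ‖∫ y, k x y * f1 y‖ₑ ≤ ENNReal.ofReal (μ / 2) := by
      intro x
      calc _ ≤ ∫⁻ y, ‖k x y * f1 y‖ₑ := enorm_integral_le_lintegral_enorm _
        _ ≤ ∫⁻ y, ENNReal.ofReal (A * l ^ (1 - r)) * ‖f y‖ₑ ^ r := by
            apply lintegral_mono
            intro y
            dsimp only
            rw [hf1, ← ofReal_norm, ← ofReal_norm, ENNReal.ofReal_rpow_of_nonneg (by positivity) (by positivity),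
              ← ENNReal.ofReal_mul (by positivity)]
            apply ENNReal.ofReal_le_ofReal
            by_cases hy : ‖f y‖ ≤ l
            · rw [Set.indicator_of_notMem (by simpa using hy)]
              simp; positivity
            · rw [Set.indicator_of_mem (by simpa using hy), norm_mul, mul_assoc]
              rw [not_le] at hy
              have hy0 : 0 < ‖f y‖ := hl0.trans hy
              have : ‖f y‖ = ‖f y‖ ^ (1 - r) * ‖f y‖ ^ r := by
                rw [← Real.rpow_add hy0]; simp
              refine mul_le_mul (hkA x y) ?_ (by positivity) hA.le
              conv_lhs => rw [this]
              gcongr ?_ * _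
              exact Real.rpow_le_rpow_of_nonpos hl0 hy.le (by linarith)
        _ = _ := by
            rw [lintegral_const_mul' _ _ ENNReal.ofReal_ne_top, hN', ← ENNReal.ofReal_mul (by positivity)]
            congr 1
            rw [hl, ← Real.rpow_mul (by positivity), show (p - 1) * (1 - r) = -1 by rw [hr]; field_simp; ring, Real.rpow_neg_one]
            field_simp
    have sub : {x | ENNReal.ofReal μ < ‖∫ y, k x y * f y‖ₑ} ⊆
        {x | ENNReal.ofReal (μ ^ 2 / 4) ≤ ‖∫ y, k x y * f2 y‖ₑ ^ 2} := by
      intro x hx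
      have hx : ENNReal.ofReal μ < ‖∫ y, k x y * f y‖ₑ := hx
      have e : ∫ y, k x y * f y = (∫ y, k x y * f1 y) + ∫ y, k x y * f2 y := by
        rw [← integral_add (hintg f1 n1 x) (hintg f2 n2 x)]
        congr 1; ext y
        rw [← mul_add, hf1, hf2, ← Pi.add_apply, Set.indicator_compl_add_self]
      show ENNReal.ofReal (μ ^ 2 / 4) ≤ ‖∫ y, k x y * f2 y‖ₑ ^ 2
      rw [show μ ^ 2 / 4 = (μ / 2) ^ 2 by ring, ENNReal.ofReal_pow (by positivity)]
      gcongr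
      by_contra hcon
      rw [not_le] at hcon
      have := (enorm_add_le (∫ y, k x y * f1 y) (∫ y, k x y * f2 y)).trans (add_le_add (b1 x) hcon.le)
      rw [← e, ← ENNReal.ofReal_add (by positivity) (by positivity), add_halves] at this
      exact absurd hx (not_lt.2 this)
    refine (measure_mono sub).trans ?_
    refine (meas_ge_le_lintegral_div ((hS f2 n2).pow_const 2).aemeasurable (by simp; positivity) (by simp)).trans ?_
    refine (ENNReal.div_le_div_right (h2 f2 n2) _).trans ?_
    rw [div_eq_mul_inv, ← ENNReal.ofReal_inv_of_pos (by positivity), mul_comm]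
    apply le_of_eq
    congr 1
    · congr 1
      rw [Real.rpow_neg hμ.le]; norm_num; ring
    · congr 1; ext y
      rw [hf2, Set.indicator_apply]
      simp only [Set.mem_ofPred_eq]
      split_ifs
      · rw [ENNReal.ofReal_pow (norm_nonneg _), ofReal_norm]
      · simp

lemma interp {p : ℝ} (hp : 2 < p) {k : V → V → ℂ} {A : ℝ} (hA : 0 < A)
    (hk : Measurable (Function.uncurry k)) (hkA : ∀ x y, ‖k x y‖ ≤ A)
    (h2 : ∀ f : V → ℂ, Nice f → ∫⁻ x, ‖∫ y, k x y * f y‖ₑ ^ 2 ≤ ∫⁻ x, ‖f x‖ₑ ^ 2)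
    {f g : V → ℂ} (hf : Nice f) (hg : Nice g) :
    ‖∫ x, (∫ y, k x y * f y) * g x‖ₑ ≤
      ENNReal.ofReal ((4 * p / (p - 2) * 2 ^ (p - 2)) ^ (1 / p) * A ^ (1 - 2 / p)) *
        (∫⁻ x, ‖f x‖ₑ ^ (p / (p - 1))) ^ (1 / (p / (p - 1))) * (∫⁻ x, ‖g x‖ₑ ^ (p / (p - 1))) ^ (1 / (p / (p - 1))) := by
  have hc : p.HolderConjugate (p / (p - 1)) := Real.HolderConjugate.conjExponent (by linarith)
  have hmf := hf.meas
  have hmg := hg.meas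
  have hS : Measurable fun x => ‖∫ y, k x y * f y‖ₑ := by
    apply Measurable.enorm
    apply StronglyMeasurable.measurable
    exact StronglyMeasurable.integral_prod_right' (f := fun z : V × V => k z.1 z.2 * f z.2)
      (Measurable.stronglyMeasurable (hk.mul (hmf.comp measurable_snd)))
  refine (enorm_integral_le_lintegral_enorm _).trans ?_
  simp_rw [enorm_mul]
  exact (ENNReal.lintegral_mul_le_Lp_mul_Lq volume hc hS.aemeasurable hmg.enorm.aemeasurable).trans
        (mul_le_mul_left (interp_norm hp hA hk hkA h2 hf) _)

end Stz

namespace Stz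

section gen
variable {X α β : Type*} [MeasureSpace X] [MeasureSpace α] [MeasureSpace β]
    [SFinite (volume : Measure X)] [SFinite (volume : Measure α)] [SFinite (volume : Measure β)]

lemma int_prod_of_bound {U : X → α → ℂ} (hU : Measurable (Function.uncurry U)) {g : X → ℝ} {h : α → ℝ}
    (hg : Integrable g) (hh : Integrable h) (hb : ∀ x s, ‖U x s‖ ≤ g x * h s) :
    Integrable (Function.uncurry U) :=
  (hg.mul_prod hh).mono' hU.aestronglyMeasurable (Filter.Eventually.of_forall fun z => hb z.1 z.2)

lemma meas_int {U : X → α → ℂ} (hU : Measurable (Function.uncurry U)) : Measurable fun x => ∫ s, U x s :=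
  (StronglyMeasurable.integral_prod_right' (f := fun z : X × α => U z.1 z.2)
      hU.stronglyMeasurable).measurable

lemma meas_int' {U : X → α → ℂ} (hU : Measurable (Function.uncurry U)) : Measurable fun s => ∫ x, U x s :=
  (StronglyMeasurable.integral_prod_left' (f := fun z : X × α => U z.1 z.2)
      hU.stronglyMeasurable).measurable

lemma norm_int_le {U : X → α → ℂ} {h : α → ℝ} (hh : Integrable h) (hb : ∀ x s, ‖U x s‖ ≤ h s) (x : X) :
    ‖∫ s, U x s‖ ≤ ∫ s, h s :=
  norm_integral_le_of_norm_le hh (Filter.Eventually.of_forall fun s => hb x s)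

lemma tri_bil {g : X → ℂ} (hgm : Measurable g) (hg : Integrable g) {U : X → α → ℂ} {U' : X → β → ℂ}
    (hU : Measurable (Function.uncurry U)) (hU' : Measurable (Function.uncurry U'))
    {h : α → ℝ} {h' : β → ℝ} (hh : Integrable h) (hh' : Integrable h')
    (hb : ∀ x s, ‖U x s‖ ≤ h s) (hb' : ∀ x s, ‖U' x s‖ ≤ h' s) :
    ∫ x, g x * (∫ s, U x s) * (∫ s, U' x s) = ∫ s', ∫ s, ∫ x, g x * U x s * U' x s' := by
  have mU := meas_int hU
  calc _ = ∫ x, ∫ s', g x * (∫ s, U x s) * U' x s' := by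
        congr 1; ext x; rw [integral_const_mul]
    _ = ∫ s', ∫ x, g x * (∫ s, U x s) * U' x s' := by
        apply integral_integral_swap
        refine int_prod_of_bound ?_ (hg.norm.mul_const (∫ s, h s)) hh' ?_
        · exact ((hgm.comp measurable_fst).mul (mU.comp measurable_fst)).mul hU'
        · intro x s'
          rw [norm_mul, norm_mul]
          have := norm_int_le hh hb x
          have h0 := (norm_nonneg _).trans this
          gcongr
          exact hb' x s'
    _ = ∫ s', ∫ x, ∫ s, g x * U x s * U' x s' := by
        congr 1; ext s'; congr 1; ext x
        rw [integral_mul_const, integral_const_mul]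
    _ = _ := by
        congr 1; ext s'
        apply integral_integral_swap
        refine int_prod_of_bound ?_ (hg.norm.mul_const (h' s')) hh ?_
        · exact ((hgm.comp measurable_fst).mul hU).mul
            (hU'.comp (measurable_fst.prodMk measurable_const) : Measurable fun z : X × α => U' z.1 s')
        · intro x s
          rw [norm_mul, norm_mul, mul_assoc, mul_assoc, mul_comm (h' s')]
          have h0 := (norm_nonneg _).trans (hb x s)
          gcongr
          · exact hb x s
          · exact hb' x s'

lemma lint_eq_quad {g : X → ℝ} (hg : Integrable g) (hg0 : ∀ x, 0 ≤ g x)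
    {F : X → ℂ} (hF : Measurable F) {M : ℝ} (hM : ∀ x, ‖F x‖ ≤ M) :
    ∫⁻ x, ENNReal.ofReal (g x) * ‖F x‖ₑ ^ 2 = ‖∫ x, (g x : ℂ) * F x * starRingEnd ℂ (F x)‖ₑ := by
  have e : ∀ x, (g x : ℂ) * F x * starRingEnd ℂ (F x) = ((g x * ‖F x‖ ^ 2 : ℝ) : ℂ) := by
    intro x
    rw [mul_assoc, Complex.mul_conj, Complex.normSq_eq_norm_sq]; push_cast; rfl
  simp_rw [e]
  rw [integral_complex_ofReal, ← ofReal_norm, Complex.norm_real, Real.norm_of_nonneg (integral_nonneg fun x => by have := hg0 x; positivity),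
    ofReal_integral_eq_lintegral_ofReal]
  · congr 1; ext x
    rw [ENNReal.ofReal_mul (hg0 x), ENNReal.ofReal_pow (norm_nonneg _), ofReal_norm]
  · refine Integrable.mono' (hg.mul_const (M ^ 2)) (hg.1.mul (by fun_prop)) (Filter.Eventually.of_forall fun x => ?_)
    have := hg0 x
    rw [Real.norm_of_nonneg (by positivity)]
    gcongr
    exact hM x
  · exact Filter.Eventually.of_forall fun x => by have := hg0 x; positivity

end gen

variable {V : Type*} [NormedAddCommGroup V] [InnerProductSpace ℝ V] [FiniteDimensional ℝ V]
    [MeasurableSpace V] [BorelSpace V]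

/-- gaussian weight -/
noncomputable def gw (δ : ℝ) (x : V) : ℝ := rexp (-δ * ‖x‖ ^ 2)

lemma gw_int {δ : ℝ} (h : 0 < δ) : Integrable (gw δ : V → ℝ) := by
  have := (GaussianFourier.integrable_cexp_neg_mul_sq_norm_add (b := δ) (by simpa using h) 0 (0 : V)).norm
  refine this.congr (Filter.Eventually.of_forall fun x => ?_)
  simp [gw, Complex.norm_exp]
  left; norm_cast

lemma gw_nonneg (δ : ℝ) (x : V) : 0 ≤ gw δ x := (Real.exp_pos _).le

lemma gw_le_one {δ : ℝ} (h : 0 < δ) (x : V) : gw δ x ≤ 1 := by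
  rw [gw, Real.exp_le_one_iff]; nlinarith [sq_nonneg ‖x‖]

lemma gw_meas (δ : ℝ) : Measurable (gw δ : V → ℝ) := by unfold gw; fun_prop

lemma gw_fatou {G : V → ℝ≥0∞} (hG : Measurable G) {B : ℝ≥0∞}
    (h : ∀ δ : ℝ, 0 < δ → ∫⁻ x, ENNReal.ofReal (gw δ x) * G x ≤ B) : ∫⁻ x, G x ≤ B := by
  have hl := lintegral_liminf_le (μ := (volume : Measure V)) (u := Filter.atTop)
    (f := fun (n : ℕ) x => ENNReal.ofReal (gw (1 / ((n : ℝ) + 1)) x) * G x)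
    (fun n => ((gw_meas _).ennreal_ofReal).mul hG)
  have e : ∀ x, Filter.liminf (fun n : ℕ => ENNReal.ofReal (gw (1 / ((n : ℝ) + 1)) x) * G x) Filter.atTop = G x := by
    intro x
    apply Filter.Tendsto.liminf_eq
    have h1 : Filter.Tendsto (fun n : ℕ => gw (1 / ((n : ℝ) + 1)) x) Filter.atTop (nhds 1) := by
      have := (tendsto_one_div_add_atTop_nhds_zero_nat (𝕜 := ℝ)).neg.mul_const (‖x‖ ^ 2)
      have := (Real.continuous_exp.tendsto _).comp this
      simpa [gw, Function.comp_def] using this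
    have h2 := ENNReal.Tendsto.mul_const (b := G x) (ENNReal.tendsto_ofReal h1) (Or.inl (by simp))
    simpa using h2
  simp_rw [e] at hl
  refine hl.trans ?_
  refine (Filter.liminf_le_liminf (v := fun _ => B) (Filter.Eventually.of_forall fun n => h _ (by positivity))).trans ?_
  simp

/-- the Schrodinger kernel -/
noncomputable def K (a : ℝ) (z : V) : ℂ :=
  (4 * Real.pi * Complex.I * a) ^ (-(Module.finrank ℝ V : ℂ) / 2) *
        Complex.exp (Complex.I * ((‖z‖ : ℝ) ^ 2 : ℝ) / (4 * a))

lemma K_meas : Measurable (fun z : ℝ × V => K z.1 z.2) := by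
  unfold K; fun_prop

lemma norm_K {a : ℝ} (ha : 0 < a) (z : V) : ‖K a z‖ = (4 * π * a) ^ (-((Module.finrank ℝ V : ℝ) / 2)) := by
  rw [K, norm_mul, Complex.norm_exp]
  have e : (Complex.I * ((‖z‖ : ℝ) ^ 2 : ℝ) / (4 * a)) = ((‖z‖ ^ 2 / (4 * a) : ℝ) : ℂ) * Complex.I := by
    push_cast; ring
  have e2 : (-(Module.finrank ℝ V : ℂ) / 2) = ((-((Module.finrank ℝ V : ℝ) / 2) : ℝ) : ℂ) := by
    push_cast; ring
  rw [e, Complex.re_ofReal_mul, Complex.I_re, e2, norm_cpow_real]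
  simp [abs_of_pos ha, abs_of_pos Real.pi_pos]

lemma K_neg (a : ℝ) (z : V) : K a (-z) = K a z := by simp [K]

/-- the regularized composed kernel -/
noncomputable def J (δ a b : ℝ) (y z : V) : ℂ := ∫ x, (gw δ x : ℂ) * K a (x - y) * starRingEnd ℂ (K b (x - z))

lemma norm_J {δ a b : ℝ} (hδ : 0 < δ) (ha : 0 < a) (hb : 0 < b) (y z : V) :
    ‖J δ a b y z‖ = (4 * π * a) ^ (-((Module.finrank ℝ V : ℝ) / 2)) * (4 * π * b) ^ (-((Module.finrank ℝ V : ℝ) / 2)) *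
      (π / ‖(⟨δ, 1 / (4 * b) - 1 / (4 * a)⟩ : ℂ)‖) ^ ((Module.finrank ℝ V : ℝ) / 2) *
      rexp (- (‖(1 / (2 * a)) • y - (1 / (2 * b)) • z‖ ^ 2 * δ / (4 * ‖(⟨δ, 1 / (4 * b) - 1 / (4 * a)⟩ : ℂ)‖ ^ 2))) := by
  obtain ⟨β, hβ⟩ : ∃ β : ℂ, β = ⟨δ, 1 / (4 * b) - 1 / (4 * a)⟩ := ⟨_, rfl⟩
  have hβr : β.re = δ := by rw [hβ]
  have hβ' : β = δ + (1 / (4 * b) - 1 / (4 * a)) * Complex.I := by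
    rw [hβ]; apply Complex.ext <;> simp
  rw [← hβ]
  have key := GaussianFourier.integral_cexp_neg_mul_sq_norm_add (b := β) (by rw [hβr]; exact hδ) (-Complex.I) ((1 / (2 * a)) • y - (1 / (2 * b)) • z)
  obtain ⟨ca, hca⟩ : ∃ c : ℂ, c = (4 * Real.pi * Complex.I * a) ^ (-(Module.finrank ℝ V : ℂ) / 2) := ⟨_, rfl⟩
  obtain ⟨cb, hcb⟩ : ∃ c : ℂ, c = (4 * Real.pi * Complex.I * b) ^ (-(Module.finrank ℝ V : ℂ) / 2) := ⟨_, rfl⟩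
  have nca : ‖ca‖ = (4 * π * a) ^ (-((Module.finrank ℝ V : ℝ) / 2)) := by
    have := norm_K ha (0 : V); rw [← this, K, hca]; simp
  have ncb : ‖cb‖ = (4 * π * b) ^ (-((Module.finrank ℝ V : ℝ) / 2)) := by
    have := norm_K hb (0 : V); rw [← this, K, hcb]; simp
  have e : ∀ x : V, (gw δ x : ℂ) * K a (x - y) * starRingEnd ℂ (K b (x - z)) =
      (ca * starRingEnd ℂ cb * cexp (Complex.I * (‖y‖ ^ 2 / (4 * a) - ‖z‖ ^ 2 / (4 * b) : ℝ))) *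
        cexp (-β * ‖x‖ ^ 2 + -Complex.I * inner ℝ ((1 / (2 * a)) • y - (1 / (2 * b)) • z) x) := by
    intro x
    rw [K, K, ← hca, ← hcb, gw, map_mul, ← Complex.exp_conj]
    rw [show ∀ A B C D E F G : ℂ, A * (B * C) * (D * E) = B * D * (A * C * E) from fun _ _ _ _ _ _ _ => by ring, mul_assoc (ca * _)]
    · congr 1
      rw [Complex.ofReal_exp, ← Complex.exp_add, ← Complex.exp_add, ← Complex.exp_add]
      congr 1
      rw [hβ', norm_sub_sq_real, norm_sub_sq_real, inner_sub_left, real_inner_smul_left, real_inner_smul_left, real_inner_comm, real_inner_comm x z]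
      have ha' : (a : ℂ) ≠ 0 := by exact_mod_cast ha.ne'
      have hb' : (b : ℂ) ≠ 0 := by exact_mod_cast hb.ne'
      have c4 : starRingEnd ℂ 4 = 4 := map_ofNat _ _
      have c2 : starRingEnd ℂ 2 = 2 := map_ofNat _ _
      simp [c4, c2]
      field_simp
      ring
    all_goals exact 0
  rw [J]
  simp_rw [e]
  rw [integral_const_mul, key, norm_mul, norm_mul, norm_mul, nca, RCLike.norm_conj, ncb, norm_mul, Complex.norm_exp, Complex.norm_exp]
  have e2 : ((Module.finrank ℝ V : ℂ) / 2) = (((Module.finrank ℝ V : ℝ) / 2 : ℝ) : ℂ) := by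
    push_cast; ring
  rw [mul_comm Complex.I, Complex.re_ofReal_mul, Complex.I_re, e2, norm_cpow_real, norm_div, Complex.norm_real, Real.norm_of_nonneg Real.pi_pos.le]
  simp only [mul_zero, Real.exp_zero, mul_one, mul_assoc]
  congr 4
  rw [neg_sq, Complex.I_sq]
  have : (-1 * (‖(1 / (2 * a)) • y - (1 / (2 * b)) • z‖ : ℂ) ^ 2 / (4 * β)) =
     ((-(‖(1 / (2 * a)) • y - (1 / (2 * b)) • z‖ ^ 2 / 4) : ℝ) : ℂ) * β⁻¹ := by
    push_cast; rw [mul_comm 4 β, ← div_div]; ring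
  rw [this, Complex.re_ofReal_mul, Complex.inv_re, hβr, Complex.normSq_eq_norm_sq]
  ring

lemma norm_J_le {δ a b : ℝ} (hδ : 0 < δ) (ha : 0 < a) (hb : 0 < b) (hab : a ≠ b) (y z : V) :
    ‖J δ a b y z‖ ≤ (4 * π * |a - b|) ^ (-((Module.finrank ℝ V : ℝ) / 2)) := by
  rw [norm_J hδ ha hb]
  have h0 : 0 < |a - b| := abs_pos.2 (sub_ne_zero.2 hab)
  have hβ : |a - b| / (4 * a * b) ≤ ‖(⟨δ, 1 / (4 * b) - 1 / (4 * a)⟩ : ℂ)‖ := by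
    refine le_trans (le_of_eq ?_) (Complex.abs_im_le_norm _)
    dsimp only
    rw [show 1 / (4 * b) - 1 / (4 * a) = (a - b) / (4 * a * b) by field_simp, abs_div, abs_of_pos (show 0 < 4 * a * b by positivity)]
  have hβ0 : 0 < ‖(⟨δ, 1 / (4 * b) - 1 / (4 * a)⟩ : ℂ)‖ := lt_of_lt_of_le (by positivity) hβ
  calc _ ≤ (4 * π * a) ^ (-((Module.finrank ℝ V : ℝ) / 2)) * (4 * π * b) ^ (-((Module.finrank ℝ V : ℝ) / 2)) *
      (π / (|a - b| / (4 * a * b))) ^ ((Module.finrank ℝ V : ℝ) / 2) * 1 := by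
        gcongr
        rw [Real.exp_le_one_iff, neg_nonpos]; positivity
    _ = _ := by
        rw [mul_one, Real.rpow_neg (by positivity), Real.rpow_neg (by positivity), Real.rpow_neg (by positivity),
          ← Real.inv_rpow (by positivity), ← Real.inv_rpow (by positivity), ← Real.inv_rpow (by positivity),
          ← Real.mul_rpow (by positivity) (by positivity), ← Real.mul_rpow (by positivity) (by positivity)]
        congr 1
        field_simp

/-- the diagonal gaussian -/
noncomputable def kd (δ a : ℝ) (w : V) : ℝ :=
  (4 * π * a) ^ (-((Module.finrank ℝ V : ℝ) / 2)) * (4 * π * a) ^ (-((Module.finrank ℝ V : ℝ) / 2)) *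
      (π / δ) ^ ((Module.finrank ℝ V : ℝ) / 2) * gw (1 / (16 * a ^ 2 * δ)) w

lemma norm_J_diag {δ a : ℝ} (hδ : 0 < δ) (ha : 0 < a) (y z : V) :
    ‖J δ a a y z‖ = kd δ a (z - y) := by
  rw [norm_J hδ ha ha, kd, gw, ← smul_sub, norm_smul, norm_sub_rev]
  have : (⟨δ, 1 / (4 * a) - 1 / (4 * a)⟩ : ℂ) = (δ : ℂ) := by apply Complex.ext <;> simp
  rw [this, Complex.norm_real, Real.norm_of_nonneg hδ.le, Real.norm_of_nonneg (by positivity)]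
  congr 2
  field_simp
  ring

lemma lint_kd {δ a : ℝ} (hδ : 0 < δ) (ha : 0 < a) : ∫⁻ w : V, ENNReal.ofReal (kd δ a w) = 1 := by
  unfold kd
  rw [← ofReal_integral_eq_lintegral_ofReal ((gw_int (by positivity)).const_mul _)
    (Filter.Eventually.of_forall fun x => by have := gw_nonneg (1 / (16 * a ^ 2 * δ)) x; positivity)]
  unfold gw
  rw [integral_const_mul, GaussianFourier.integral_rexp_neg_mul_sq_norm (by positivity)]
  rw [Real.rpow_neg (by positivity),
          ← Real.inv_rpow (by positivity),
          ← Real.mul_rpow (by positivity) (by positivity), ← Real.mul_rpow (by positivity) (by positivity), ← Real.mul_rpow (by positivity) (by positivity)]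
  rw [show (4 * π * a)⁻¹ * (4 * π * a)⁻¹ * (π / δ) * (π / (1 / (16 * a ^ 2 * δ))) = 1 by field_simp; norm_num]
  simp

end Stz

namespace Stz

variable {V : Type*} [NormedAddCommGroup V] [InnerProductSpace ℝ V] [FiniteDimensional ℝ V]
    [MeasurableSpace V] [BorelSpace V]

lemma Nice.conj {α : Type*} [MeasureSpace α] {f : α → ℂ} (hf : Nice f) : Nice fun x => starRingEnd ℂ (f x) := by
  obtain ⟨M, hM⟩ := hf.bdd
  refine ⟨?_, ⟨M, fun x => by rw [RCLike.norm_conj]; exact hM x⟩, ?_⟩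
  · exact (Complex.continuous_conj.measurable).comp hf.meas
  · have := Complex.conjLIE.toContinuousLinearEquiv.toContinuousLinearMap.integrable_comp hf.int
    exact this

lemma K_meas_sub (a : ℝ) : Measurable (fun z : V × V => K a (z.1 - z.2)) :=
  K_meas.comp (measurable_const.prodMk (measurable_fst.sub measurable_snd))

lemma K_meas_of {X : Type*} [MeasurableSpace X] (a : ℝ) {h : X → V} (hh : Measurable h) : Measurable fun x => K a (h x) :=
  K_meas.comp (measurable_const.prodMk hh)

lemma conj_meas_of {X : Type*} [MeasurableSpace X] {h : X → ℂ} (hh : Measurable h) : Measurable fun x => starRingEnd ℂ (h x) :=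
  Complex.continuous_conj.measurable.comp hh

lemma gw_meas_of {X : Type*} [MeasurableSpace X] (δ : ℝ) {h : X → V} (hh : Measurable h) : Measurable fun x => (gw δ (h x) : ℂ) :=
  Complex.measurable_ofReal.comp ((gw_meas δ).comp hh)

/-- the propagator -/
noncomputable def Tk (a : ℝ) (f : V → ℂ) (x : V) : ℂ := ∫ y, K a (x - y) * f y

lemma Kf_meas (a : ℝ) {f : V → ℂ} (hf : Measurable f) :
    Measurable (Function.uncurry fun (x y : V) => K a (x - y) * f y) :=
  (K_meas_sub a).mul (hf.comp measurable_snd)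

lemma Tk_meas (a : ℝ) {f : V → ℂ} (hf : Measurable f) : Measurable (Tk a f) :=
  meas_int (Kf_meas a hf)

lemma Kf_bd {a : ℝ} (ha : 0 < a) (f : V → ℂ) (x y : V) :
    ‖K a (x - y) * f y‖ ≤ (4 * π * a) ^ (-((Module.finrank ℝ V : ℝ) / 2)) * ‖f y‖ := by
  rw [norm_mul, norm_K ha]

lemma Tk_bdd {a : ℝ} (ha : 0 < a) {f : V → ℂ} (hf : Nice f) (x : V) :
    ‖Tk a f x‖ ≤ ∫ y, (4 * π * a) ^ (-((Module.finrank ℝ V : ℝ) / 2)) * ‖f y‖ :=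
  norm_int_le (hf.int.norm.const_mul _) (Kf_bd ha f) x

lemma gw_Nice {δ : ℝ} (hδ : 0 < δ) {F : V → ℂ} (hF : Measurable F) {M : ℝ} (hM : ∀ x, ‖F x‖ ≤ M) :
    Nice fun x => (gw δ x : ℂ) * F x := by
  have hb : ∀ x, ‖(gw δ x : ℂ) * F x‖ ≤ gw δ x * M := fun x => by
    rw [norm_mul, Complex.norm_real, Real.norm_of_nonneg (gw_nonneg _ _)]
    exact mul_le_mul_of_nonneg_left (hM x) (gw_nonneg _ _)
  have hm : Measurable fun x => (gw δ x : ℂ) * F x := (Complex.measurable_ofReal.comp (gw_meas δ)).mul hF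
  refine ⟨hm, ⟨M, fun x => (hb x).trans ?_⟩, ?_⟩
  · exact mul_le_of_le_one_left ((norm_nonneg _).trans (hM x)) (gw_le_one hδ x)
  · exact ((gw_int hδ).mul_const M).mono' hm.aestronglyMeasurable (Filter.Eventually.of_forall hb)

lemma bil_J {δ a b : ℝ} (hδ : 0 < δ) (ha : 0 < a) (hb : 0 < b) {f h : V → ℂ} (hf : Nice f) (hh : Nice h) :
    ∫ x, (gw δ x : ℂ) * Tk a f x * starRingEnd ℂ (Tk b h x) =
      ∫ z, ∫ y, J δ a b y z * f y * starRingEnd ℂ (h z) := by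
  have e : ∀ x, starRingEnd ℂ (Tk b h x) = ∫ z, starRingEnd ℂ (K b (x - z) * h z) := fun x => by
    rw [Tk, integral_conj]
  simp_rw [e, Tk]
  rw [tri_bil (g := fun x => (gw δ x : ℂ)) (U' := fun x z => starRingEnd ℂ (K b (x - z) * h z)) (Complex.measurable_ofReal.comp (gw_meas δ)) ((gw_int hδ).ofReal) (Kf_meas a hf.meas)
    (Complex.continuous_conj.measurable.comp (Kf_meas b hh.meas)) (hf.int.norm.const_mul _) (hh.int.norm.const_mul _)
    (Kf_bd ha f) (fun x s => by rw [RCLike.norm_conj]; exact Kf_bd hb h x s)]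
  congr 1; ext z; congr 1; ext y
  rw [J, ← integral_mul_const, ← integral_mul_const]
  congr 1; ext x
  rw [map_mul]; ring

lemma L2 {a : ℝ} (ha : 0 < a) {f : V → ℂ} (hf : Nice f) : ∫⁻ x, ‖Tk a f x‖ₑ ^ 2 ≤ ∫⁻ x, ‖f x‖ₑ ^ 2 := by
  have hmf := hf.meas
  apply gw_fatou
  · have := Tk_meas a hf.meas; fun_prop
  intro δ hδ
  rw [lint_eq_quad (gw_int hδ) (gw_nonneg δ) (Tk_meas a hf.meas) (Tk_bdd ha hf), bil_J hδ ha ha hf hf]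
  have mk : Measurable (fun w : V => ENNReal.ofReal (kd δ a w)) := by
    unfold kd
    exact ((gw_meas _).const_mul _).ennreal_ofReal
  have mk2 : Measurable (fun w : V × V => ENNReal.ofReal (kd δ a (w.1 - w.2))) := mk.comp (measurable_fst.sub measurable_snd)
  have mI : Measurable fun z => ∫⁻ y, ENNReal.ofReal (kd δ a (z - y)) * ‖f y‖ₑ :=
    Measurable.lintegral_prod_right' (f := fun w : V × V => ENNReal.ofReal (kd δ a (w.1 - w.2)) * ‖f w.2‖ₑ)
      (by fun_prop)
  calc _ ≤ ∫⁻ z, ∫⁻ y, ‖J δ a a y z * f y * starRingEnd ℂ (f z)‖ₑ :=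
        (enorm_integral_le_lintegral_enorm _).trans (lintegral_mono fun z => enorm_integral_le_lintegral_enorm _)
    _ = ∫⁻ z, (∫⁻ y, ENNReal.ofReal (kd δ a (z - y)) * ‖f y‖ₑ) * ‖f z‖ₑ := by
        congr 1; ext z
        have : Measurable fun y => ENNReal.ofReal (kd δ a (z - y)) := mk.comp (measurable_const.sub measurable_id)
        rw [← lintegral_mul_const _ (by fun_prop)]
        congr 1; ext y
        rw [enorm_mul, enorm_mul, RCLike.enorm_conj, ← ofReal_norm (J δ a a y z), norm_J_diag hδ ha]
    _ ≤ (∫⁻ z, (∫⁻ y, ENNReal.ofReal (kd δ a (z - y)) * ‖f y‖ₑ) ^ (2 : ℝ)) ^ (1 / (2 : ℝ)) * (∫⁻ z, ‖f z‖ₑ ^ (2 : ℝ)) ^ (1 / (2 : ℝ)) :=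
        ENNReal.lintegral_mul_le_Lp_mul_Lq volume (Real.HolderConjugate.two_two) mI.aemeasurable hmf.enorm.aemeasurable
    _ ≤ (∫⁻ z, ‖f z‖ₑ ^ (2 : ℝ)) ^ (1 / (2 : ℝ)) * (∫⁻ z, ‖f z‖ₑ ^ (2 : ℝ)) ^ (1 / (2 : ℝ)) := by
        gcongr ?_ ^ (1 / (2 : ℝ)) * _
        have := young_two (V := V) mk hmf.enorm
        rw [lint_kd hδ ha] at this
        simpa using this
    _ = _ := by
        rw [← ENNReal.rpow_add_of_nonneg _ _ (by norm_num) (by norm_num)]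
        norm_num

lemma adm_rpow {n p q : ℝ} (hq : 2 / q = n / 2 - n / p) {s : ℝ} (hs : 0 ≤ s) :
    ((4 * π * s) ^ (-(n / 2))) ^ (1 - 2 / p) = (4 * π) ^ (-(2 / q)) * s ^ (-(2 / q)) := by
  rw [← Real.rpow_mul (by positivity), ← Real.mul_rpow (by positivity) hs]
  congr 1
  rw [hq]; ring

/-- dispersive constant -/
noncomputable def Cd (p q : ℝ) : ℝ := (4 * p / (p - 2) * 2 ^ (p - 2)) ^ (1 / p) * (4 * π) ^ (-(2 / q))

lemma Cd_pos {p q : ℝ} (hp : 2 < p) : 0 < Cd p q := by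
  have : 0 < p - 2 := by linarith
  unfold Cd; positivity

/-- spatial dual norm -/
noncomputable def sn (r : ℝ) (f : V → ℂ) : ℝ≥0∞ := (∫⁻ x, ‖f x‖ₑ ^ r) ^ (1 / r)

lemma disp1 {p q : ℝ} (hp : 2 < p) (hq : 2 / q = (Module.finrank ℝ V : ℝ) / 2 - (Module.finrank ℝ V : ℝ) / p)
    {a : ℝ} (ha : 0 < a) {f g : V → ℂ} (hf : Nice f) (hg : Nice g) :
    ‖∫ x, Tk a f x * g x‖ₑ ≤ ENNReal.ofReal (Cd p q * a ^ (-(2 / q))) * sn (p / (p - 1)) f * sn (p / (p - 1)) g := by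
  have := interp (V := V) hp (k := fun x y => K a (x - y)) (A := (4 * π * a) ^ (-((Module.finrank ℝ V : ℝ) / 2))) (by positivity)
    (K_meas_sub a) (fun x y => (norm_K ha _).le) (fun f hf => L2 ha hf) hf hg
  rw [adm_rpow hq ha.le, ← mul_assoc] at this
  exact this

lemma disp2 {p q : ℝ} (hp : 2 < p) (hq : 2 / q = (Module.finrank ℝ V : ℝ) / 2 - (Module.finrank ℝ V : ℝ) / p)
    {δ a b : ℝ} (hδ : 0 < δ) (ha : 0 < a) (hb : 0 < b) (hab : a ≠ b) {f h : V → ℂ} (hf : Nice f) (hh : Nice h) :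
    ‖∫ x, (gw δ x : ℂ) * Tk a f x * starRingEnd ℂ (Tk b h x)‖ₑ ≤
      ENNReal.ofReal (Cd p q * |a - b| ^ (-(2 / q))) * sn (p / (p - 1)) f * sn (p / (p - 1)) h := by
  have hab0 : 0 < |a - b| := abs_pos.2 (sub_ne_zero.2 hab)
  rw [bil_J hδ ha hb hf hh]
  have mJ : Measurable (Function.uncurry fun (z y : V) => J δ a b y z) := by
    refine meas_int (X := V × V) (U := fun w x => (gw δ x : ℂ) * K a (x - w.2) * starRingEnd ℂ (K b (x - w.1))) ?_
    exact ((gw_meas_of δ (by fun_prop)).mul (K_meas_of a (by fun_prop))).mul (conj_meas_of (K_meas_of b (by fun_prop)))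
  have := interp (V := V) hp (k := fun z y => J δ a b y z) (A := (4 * π * |a - b|) ^ (-((Module.finrank ℝ V : ℝ) / 2))) (by positivity)
    mJ (fun z y => norm_J_le hδ ha hb hab y z) ?_ hf hh.conj
  · rw [adm_rpow hq hab0.le, ← mul_assoc] at this
    simp_rw [RCLike.enorm_conj] at this
    simp_rw [integral_mul_const]
    exact this
  · intro f hf
    have nF := (gw_Nice hδ (Tk_meas a hf.meas) (Tk_bdd ha hf)).conj
    calc _ = ∫⁻ z, ‖Tk b (fun x => starRingEnd ℂ ((gw δ x : ℂ) * Tk a f x)) z‖ₑ ^ 2 := by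
          congr 1; ext z
          congr 1
          rw [← RCLike.enorm_conj, Tk, ← integral_conj]
          congr 1
          have e1 : ∀ x, K b (z - x) * starRingEnd ℂ ((gw δ x : ℂ) * Tk a f x) =
              starRingEnd ℂ (∫ y, starRingEnd ℂ (K b (x - z)) * (gw δ x : ℂ) * (K a (x - y) * f y)) := by
            intro x
            rw [integral_const_mul, ← Tk, map_mul, map_mul, map_mul, Complex.conj_conj, ← K_neg, neg_sub]; ring
          simp_rw [e1]
          rw [integral_conj, integral_conj]
          congr 1
          rw [integral_integral_swap]
          · congr 1; ext y
            rw [J, ← integral_mul_const]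
            congr 1; ext x; ring
          · refine int_prod_of_bound ?_ ((gw_int hδ).const_mul ((4 * π * b) ^ (-((Module.finrank ℝ V : ℝ) / 2))))
              (hf.int.norm.const_mul ((4 * π * a) ^ (-((Module.finrank ℝ V : ℝ) / 2)))) ?_
            · exact ((conj_meas_of (K_meas_of b (by fun_prop))).mul (gw_meas_of δ (by fun_prop))).mul (Kf_meas a hf.meas)
            · intro x y
              rw [norm_mul, norm_mul, RCLike.norm_conj, norm_K hb, Complex.norm_real, Real.norm_of_nonneg (gw_nonneg _ _)]
              gcongr
              · have := gw_nonneg δ x; positivity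
              · exact Kf_bd ha f x y
      _ ≤ _ := L2 hb nF
      _ ≤ ∫⁻ x, ‖Tk a f x‖ₑ ^ 2 := by
          gcongr with x
          rw [RCLike.enorm_conj, enorm_mul]
          refine mul_le_of_le_one_left (zero_le) ?_
          rw [← ofReal_norm, Complex.norm_real, Real.norm_of_nonneg (gw_nonneg _ _)]
          simpa using gw_le_one hδ x
      _ ≤ _ := L2 ha hf

end Stz

namespace Stz

variable {V : Type*} [NormedAddCommGroup V] [InnerProductSpace ℝ V] [FiniteDimensional ℝ V]
    [MeasurableSpace V] [BorelSpace V]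

/-- nice space-time functions -/
structure Nice2 (u : ℝ → V → ℂ) : Prop where
  meas : Measurable (Function.uncurry u)
  bdd : ∃ M : ℝ, ∀ s y, ‖u s y‖ ≤ M
  slice : ∀ s, Integrable (u s)
  l1 : ∃ h : ℝ → ℝ, Integrable h ∧ ∀ s, ∫ y, ‖u s y‖ ≤ h s

lemma Nice2.nice {u : ℝ → V → ℂ} (hu : Nice2 u) (s : ℝ) : Nice (u s) := by
  obtain ⟨M, hM⟩ := hu.bdd
  exact ⟨hu.meas.comp measurable_prodMk_left, ⟨M, hM s⟩, hu.slice s⟩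

/-- non-endpoint admissible -/
structure Adm (V : Type*) [NormedAddCommGroup V] [InnerProductSpace ℝ V] (p q : ℝ) : Prop where
  hp : 2 < p
  hq : 2 < q
  e : 2 / q = (Module.finrank ℝ V : ℝ) / 2 - (Module.finrank ℝ V : ℝ) / p

lemma sn_meas {u : ℝ → V → ℂ} (hu : Measurable (Function.uncurry u)) (r : ℝ) : Measurable fun t => sn r (u t) := by
  unfold sn
  refine Measurable.pow_const ?_ _
  exact Measurable.lintegral_prod_right' (f := fun z : ℝ × V => ‖u z.1 z.2‖ₑ ^ r) (hu.enorm.pow_const r)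

/-- mixed norm over all times -/
noncomputable def mn (q r : ℝ) (u : ℝ → V → ℂ) : ℝ≥0∞ := (∫⁻ t, sn r (u t) ^ q) ^ (1 / q)

/-- integrand of the truncated operator -/
noncomputable def Ue (ε : ℝ) (u : ℝ → V → ℂ) (t : ℝ) (x : V) (s : ℝ) : ℂ :=
  if ε < t - s then Tk (t - s) (u s) x else 0

/-- the truncated operator -/
noncomputable def W (ε : ℝ) (u : ℝ → V → ℂ) (t : ℝ) (x : V) : ℂ := ∫ s, Ue ε u t x s

lemma Ue_meas (ε : ℝ) {u : ℝ → V → ℂ} (hu : Measurable (Function.uncurry u)) :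
    Measurable fun z : (ℝ × V) × ℝ => Ue ε u z.1.1 z.1.2 z.2 := by
  unfold Ue
  refine Measurable.ite (measurableSet_lt (by fun_prop) (by fun_prop)) ?_ measurable_const
  refine meas_int (X := (ℝ × V) × ℝ) (U := fun z y => K (z.1.1 - z.2) (z.1.2 - y) * u z.2 y) ?_
  refine Measurable.mul ?_ ?_
  · exact K_meas.comp (f := fun z : ((ℝ × V) × ℝ) × V => (z.1.1.1 - z.1.2, z.1.1.2 - z.2)) (by fun_prop)
  · exact hu.comp (f := fun z : ((ℝ × V) × ℝ) × V => (z.1.2, z.2)) (by fun_prop)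

lemma Ue_bd {ε : ℝ} (hε : 0 < ε) {u : ℝ → V → ℂ} (hu : Nice2 u) {h : ℝ → ℝ} (hh : ∀ s, ∫ y, ‖u s y‖ ≤ h s) (t : ℝ) (x : V) (s : ℝ) :
    ‖Ue ε u t x s‖ ≤ (4 * π * ε) ^ (-((Module.finrank ℝ V : ℝ) / 2)) * h s := by
  have h0 : 0 ≤ ∫ y, ‖u s y‖ := integral_nonneg fun _ => norm_nonneg _
  have h1 : 0 ≤ h s := h0.trans (hh s)
  unfold Ue
  split_ifs with hts
  · have hpos : 0 < t - s := hε.trans hts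
    refine (Tk_bdd hpos (hu.nice s) x).trans ?_
    rw [integral_const_mul]
    refine mul_le_mul ?_ (hh s) h0 (by positivity)
    apply Real.rpow_le_rpow_of_nonpos (by positivity) (by gcongr)
    rw [neg_nonpos]; positivity
  · rw [norm_zero]; positivity

lemma W_meas (ε : ℝ) {u : ℝ → V → ℂ} (hu : Measurable (Function.uncurry u)) : Measurable (Function.uncurry (W ε u)) :=
  meas_int (X := ℝ × V) (U := fun z s => Ue ε u z.1 z.2 s) (Ue_meas ε hu)

lemma W_bdd {ε : ℝ} (hε : 0 < ε) {u : ℝ → V → ℂ} (hu : Nice2 u) : ∃ M, ∀ t x, ‖W ε u t x‖ ≤ M := by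
  obtain ⟨h, hi, hh⟩ := hu.l1
  exact ⟨_, fun t x => norm_int_le (hi.const_mul _) (fun x s => Ue_bd hε hu hh t x s) x⟩

lemma pairA {p q : ℝ} (had : Adm V p q) : ∃ C : ℝ, 0 < C ∧ ∀ (ε : ℝ) (u v : ℝ → V → ℂ), 0 < ε → Nice2 u → Nice2 v →
    ‖∫ t, ∫ x, W ε u t x * v t x‖ₑ ≤ ENNReal.ofReal C * mn (q / (q - 1)) (p / (p - 1)) u * mn (q / (q - 1)) (p / (p - 1)) v := by
  obtain ⟨C, hC, h⟩ := hls had.hq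
  have hCd := Cd_pos (q := q) had.hp
  refine ⟨Cd p q * C, by positivity, fun ε u v hε hu hv => ?_⟩
  obtain ⟨g, gi, hg⟩ := hu.l1
  have key := h (fun s => sn (p / (p - 1)) (u s)) (fun s => sn (p / (p - 1)) (v s)) (sn_meas hu.meas _) (sn_meas hv.meas _)
  calc _ = ‖∫ t, ∫ s, ∫ x, Ue ε u t x s * v t x‖ₑ := by
        congr 2; ext t
        rw [← integral_integral_swap]
        · congr 1; ext x
          rw [integral_mul_const]; rfl
        · refine int_prod_of_bound ?_ ((hv.slice t).norm) (gi.const_mul ((4 * π * ε) ^ (-((Module.finrank ℝ V : ℝ) / 2)))) ?_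
          · refine Measurable.mul ?_ ?_
            · exact (Ue_meas ε hu.meas).comp (f := fun z : V × ℝ => ((t, z.1), z.2)) (by fun_prop)
            · exact hv.meas.comp (f := fun z : V × ℝ => (t, z.1)) (by fun_prop)
          · intro x s
            rw [norm_mul, mul_comm]
            exact mul_le_mul_of_nonneg_left (Ue_bd hε hu hg t x s) (norm_nonneg _)
    _ ≤ ∫⁻ t, ∫⁻ s, ‖∫ x, Ue ε u t x s * v t x‖ₑ :=
        (enorm_integral_le_lintegral_enorm _).trans (lintegral_mono fun z => enorm_integral_le_lintegral_enorm _)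
    _ ≤ ∫⁻ t, ∫⁻ s, ENNReal.ofReal (Cd p q) * (ENNReal.ofReal (|t - s| ^ (-(2 / q))) * sn (p / (p - 1)) (u s) * sn (p / (p - 1)) (v t)) := by
        gcongr with t s
        unfold Ue
        split_ifs with hts
        · have hpos : 0 < t - s := hε.trans hts
          refine (disp1 had.hp had.e hpos (hu.nice s) (hv.nice t)).trans (le_of_eq ?_)
          rw [abs_of_pos hpos, ENNReal.ofReal_mul hCd.le]; ring
        · simp
    _ = ENNReal.ofReal (Cd p q) * ∫⁻ t, ∫⁻ s, (ENNReal.ofReal (|t - s| ^ (-(2 / q))) * sn (p / (p - 1)) (u s) * sn (p / (p - 1)) (v t)) := by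
        simp_rw [lintegral_const_mul' _ _ ENNReal.ofReal_ne_top]
    _ ≤ ENNReal.ofReal (Cd p q) * _ := mul_le_mul_right key _
    _ = _ := by
        rw [ENNReal.ofReal_mul hCd.le, mn, mn]; ring

lemma pairB {p q : ℝ} (had : Adm V p q) : ∃ C : ℝ, 0 < C ∧ ∀ (ε : ℝ) (u : ℝ → V → ℂ), 0 < ε → Nice2 u →
    ∀ t, sn 2 (W ε u t) ≤ ENNReal.ofReal C * mn (q / (q - 1)) (p / (p - 1)) u := by
  obtain ⟨C, hC, h⟩ := hls had.hq
  have hCd := Cd_pos (q := q) had.hp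
  refine ⟨(Cd p q * C) ^ (1 / (2 : ℝ)), by positivity, fun ε u hε hu t => ?_⟩
  obtain ⟨g, gi, hg⟩ := hu.l1
  have key := h (fun s => sn (p / (p - 1)) (u s)) (fun s => sn (p / (p - 1)) (u s)) (sn_meas hu.meas _) (sn_meas hu.meas _)
  have mW : Measurable (W ε u t) := (W_meas ε hu.meas).comp measurable_prodMk_left
  suffices hs : ∫⁻ x, ‖W ε u t x‖ₑ ^ 2 ≤ ENNReal.ofReal (Cd p q * C) * mn (q / (q - 1)) (p / (p - 1)) u ^ 2 by
    have h2 := ENNReal.rpow_le_rpow hs (z := 1 / (2 : ℝ)) (by norm_num)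
    rw [ENNReal.mul_rpow_of_nonneg _ _ (by norm_num), ← ENNReal.rpow_natCast, ← ENNReal.rpow_mul, ENNReal.ofReal_rpow_of_pos (by positivity)] at h2
    simp only [sn]
    simpa using h2
  apply gw_fatou
  · fun_prop
  intro δ hδ
  obtain ⟨M, hM⟩ := W_bdd hε hu
  have mU : Measurable (Function.uncurry fun (x : V) (s : ℝ) => Ue ε u t x s) :=
    (Ue_meas ε hu.meas).comp (f := fun z : V × ℝ => ((t, z.1), z.2)) (by fun_prop)
  rw [lint_eq_quad (gw_int hδ) (gw_nonneg δ) mW (hM t)]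
  have e : ∀ x, starRingEnd ℂ (W ε u t x) = ∫ s, starRingEnd ℂ (Ue ε u t x s) := fun x => by
    rw [W, integral_conj]
  simp_rw [e, W]
  rw [tri_bil (g := fun x => (gw δ x : ℂ)) (U' := fun x s => starRingEnd ℂ (Ue ε u t x s)) (gw_meas_of δ measurable_id) ((gw_int hδ).ofReal) mU
    (conj_meas_of mU) (gi.const_mul _) (gi.const_mul _)
    (fun x s => Ue_bd hε hu hg t x s) (fun x s => by rw [RCLike.norm_conj]; exact Ue_bd hε hu hg t x s)]
  calc _ ≤ ∫⁻ s', ∫⁻ s, ‖∫ x, (gw δ x : ℂ) * Ue ε u t x s * starRingEnd ℂ (Ue ε u t x s')‖ₑ :=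
        (enorm_integral_le_lintegral_enorm _).trans (lintegral_mono fun z => enorm_integral_le_lintegral_enorm _)
    _ ≤ ∫⁻ s', ∫⁻ s, ENNReal.ofReal (Cd p q) * (ENNReal.ofReal (|s' - s| ^ (-(2 / q))) * sn (p / (p - 1)) (u s) * sn (p / (p - 1)) (u s')) := by
        refine lintegral_mono fun s' => lintegral_mono_ae ?_
        have : ∀ᵐ s : ℝ, s ≠ s' := by
          rw [ae_iff]; simp
        filter_upwards [this] with s hss
        unfold Ue
        split_ifs with h1 h2
        · refine (disp2 had.hp had.e hδ (hε.trans h1) (hε.trans h2) (by intro hh; apply hss; linarith) (hu.nice s) (hu.nice s')).trans (le_of_eq ?_)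
          rw [ENNReal.ofReal_mul hCd.le, show t - s - (t - s') = s' - s by ring]; ring
        · simp
        · simp
        · simp
    _ = ENNReal.ofReal (Cd p q) * ∫⁻ s', ∫⁻ s, (ENNReal.ofReal (|s' - s| ^ (-(2 / q))) * sn (p / (p - 1)) (u s) * sn (p / (p - 1)) (u s')) := by
        simp_rw [lintegral_const_mul' _ _ ENNReal.ofReal_ne_top]
    _ ≤ ENNReal.ofReal (Cd p q) * _ := mul_le_mul_right key _
    _ = _ := by
        rw [ENNReal.ofReal_mul hCd.le, mn]; ring

end Stz

namespace Stz

variable {V : Type*} [NormedAddCommGroup V] [InnerProductSpace ℝ V] [FiniteDimensional ℝ V]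
    [MeasurableSpace V] [BorelSpace V]

lemma Nice2.int_prod {u : ℝ → V → ℂ} (hu : Nice2 u) : Integrable (Function.uncurry u) := by
  obtain ⟨h, hi, hh⟩ := hu.l1
  refine (integrable_prod_iff hu.meas.aestronglyMeasurable).2 ⟨Filter.Eventually.of_forall hu.slice, ?_⟩
  refine hi.mono' ?_ (Filter.Eventually.of_forall fun s => ?_)
  · exact (hu.meas.norm.stronglyMeasurable.integral_prod_right' ).aestronglyMeasurable
  · rw [Real.norm_of_nonneg (integral_nonneg fun _ => norm_nonneg _)]
    exact hh s

lemma enorm_int_of_pos {α : Type*} [MeasureSpace α] {F : α → ℂ} (hF : Integrable F) (h : ∀ x, F x = (‖F x‖ : ℂ)) :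
    ‖∫ x, F x‖ₑ = ∫⁻ x, ‖F x‖ₑ := by
  have e : ∫ x, F x = ((∫ x, ‖F x‖ : ℝ) : ℂ) := by
    rw [← integral_complex_ofReal]; congr 1; ext x; exact h x
  rw [e, ← ofReal_norm, Complex.norm_real, Real.norm_of_nonneg (integral_nonneg fun _ => norm_nonneg _),
    ofReal_integral_norm_eq_lintegral_enorm hF]

lemma rpow_le_add {a b x e : ℝ} (ha : 0 < a) (h1 : a ≤ x) (h2 : x ≤ b) : x ^ e ≤ a ^ e + b ^ e := by
  have hx : 0 < x := ha.trans_le h1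
  have hb : 0 < b := hx.trans_le h2
  have := Real.rpow_nonneg ha.le e
  have := Real.rpow_nonneg hb.le e
  rcases le_total 0 e with he | he
  · have := Real.rpow_le_rpow hx.le h2 he; linarith
  · have := Real.rpow_le_rpow_of_nonpos ha h1 he; linarith

lemma conv_holder_trunc {p q : ℝ} (hp : 2 < p) (hq : 2 < q) {w : ℝ → V → ℂ} (hw : Measurable (Function.uncurry w)) {M : ℝ} (hM : ∀ t x, ‖w t x‖ ≤ M)
    {C : ℝ≥0∞} (h : ∀ v : ℝ → V → ℂ, Nice2 v → ‖∫ t, ∫ x, w t x * v t x‖ₑ ≤ C * mn (q / (q - 1)) (p / (p - 1)) v)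
    {R : ℝ} (hR : 0 < R) :
    ∫⁻ t, {t | |t| ≤ R ∧ ENNReal.ofReal (1 / R) ≤ ∫⁻ x in Metric.closedBall (0 : V) R, ‖w t x‖ₑ ^ p}.indicator
      (fun t => (∫⁻ x in Metric.closedBall (0 : V) R, ‖w t x‖ₑ ^ p) ^ (q / p)) t ≤ C ^ q := by
  have hp1 : 0 < p - 1 := by linarith
  have hq1 : 0 < q - 1 := by linarith
  have hp0 : 0 < p := by linarith
  have hq0 : 0 < q := by linarith
  have hM0 : 0 ≤ M := (norm_nonneg _).trans (hM 0 0)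
  obtain ⟨B, hB⟩ : ∃ B, B = Metric.closedBall (0 : V) R := ⟨_, rfl⟩
  have mB : MeasurableSet B := by rw [hB]; exact Metric.isClosed_closedBall.measurableSet
  have vB : volume B < ⊤ := by rw [hB]; exact measure_closedBall_lt_top
  obtain ⟨P, hP⟩ : ∃ P : ℝ → ℝ≥0∞, P = fun t => ∫⁻ x in Metric.closedBall (0 : V) R, ‖w t x‖ₑ ^ p := ⟨_, rfl⟩
  have hP' : ∀ t, ∫⁻ x in Metric.closedBall (0 : V) R, ‖w t x‖ₑ ^ p = P t := fun t => by rw [hP]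
  simp_rw [hP']
  obtain ⟨S, hS⟩ : ∃ S, S = {t | |t| ≤ R ∧ ENNReal.ofReal (1 / R) ≤ P t} := ⟨_, rfl⟩
  rw [← hS]
  have mP : Measurable P := by
    rw [hP]
    exact Measurable.lintegral_prod_right' (f := fun z : ℝ × V => ‖w z.1 z.2‖ₑ ^ p) (hw.enorm.pow_const p)
  have mS : MeasurableSet S := by
    rw [hS]
    exact (measurableSet_le (f := fun t : ℝ => |t|) (g := fun _ => R) (by fun_prop) (by fun_prop)).inter
      (measurableSet_le measurable_const mP)
  have hPb : ∀ t, P t ≤ ENNReal.ofReal M ^ p * volume B := by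
    intro t
    rw [← hP', ← hB]
    calc _ ≤ ∫⁻ x in B, ENNReal.ofReal M ^ p := by
          gcongr with x
          rw [← ofReal_norm]; exact ENNReal.ofReal_le_ofReal (hM t x)
      _ = _ := by simp
  have hbt : ENNReal.ofReal M ^ p * volume B < ⊤ := ENNReal.mul_lt_top (ENNReal.rpow_lt_top_of_nonneg hp0.le ENNReal.ofReal_ne_top) vB
  have hPt : ∀ t, P t ≠ ⊤ := fun t => ((hPb t).trans_lt hbt).ne
  obtain ⟨b, hb⟩ : ∃ b, b = (ENNReal.ofReal M ^ p * volume B).toReal := ⟨_, rfl⟩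
  have hPr : ∀ t ∈ S, 1 / R ≤ (P t).toReal ∧ (P t).toReal ≤ b := by
    intro t ht
    rw [hS] at ht
    refine ⟨(ENNReal.ofReal_le_iff_le_toReal (hPt t)).1 ht.2, ?_⟩
    rw [hb]
    exact ENNReal.toReal_mono hbt.ne (hPb t)
  obtain ⟨c, hc⟩ : ∃ c : ℝ → ℝ, c = fun t => (P t).toReal ^ ((q - p) / p) := ⟨_, rfl⟩
  have mc : Measurable c := by rw [hc]; fun_prop
  have hc0 : ∀ t, 0 ≤ c t := fun t => by rw [hc]; positivity
  have hcE : ∀ t ∈ S, ENNReal.ofReal (c t) = P t ^ ((q - p) / p) := by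
    intro t ht
    have := (hPr t ht).1
    have : 0 < (P t).toReal := lt_of_lt_of_le (by positivity) this
    simp only [hc]
    rw [← ENNReal.ofReal_rpow_of_pos this, ENNReal.ofReal_toReal (hPt t)]
  obtain ⟨D, hD⟩ : ∃ D : ℝ, D = (1 / R) ^ ((q - p) / p) + b ^ ((q - p) / p) := ⟨_, rfl⟩
  have hcD : ∀ t ∈ S, c t ≤ D := fun t ht => by
    rw [hD, hc]; exact rpow_le_add (by positivity) (hPr t ht).1 (hPr t ht).2
  -- the test function
  obtain ⟨v, hv⟩ : ∃ v : ℝ → V → ℂ, v = fun t x => (S ×ˢ B).indicator (fun z : ℝ × V => starRingEnd ℂ (w z.1 z.2) * ((‖w z.1 z.2‖ ^ (p - 2) * c z.1 : ℝ) : ℂ)) (t, x) := ⟨_, rfl⟩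
  have mv : Measurable (Function.uncurry v) := by
    rw [hv]
    refine Measurable.indicator ?_ (mS.prod mB)
    refine (conj_meas_of hw).mul (Complex.measurable_ofReal.comp ?_)
    exact (hw.norm.pow_const _).mul (mc.comp measurable_fst)
  have hvS : ∀ t x, t ∈ S → x ∈ B → v t x = starRingEnd ℂ (w t x) * ((‖w t x‖ ^ (p - 2) * c t : ℝ) : ℂ) := by
    intro t x ht hx
    simp only [hv]; rw [Set.indicator_of_mem (Set.mk_mem_prod ht hx)]
  have hvS' : ∀ t x, ¬ (t ∈ S ∧ x ∈ B) → v t x = 0 := by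
    intro t x htx
    simp only [hv]; rw [Set.indicator_of_notMem (by simpa using htx)]
  have hpow : ∀ r : ℝ, 0 ≤ r → r * r ^ (p - 2) = r ^ (p - 1) := by
    intro r hr
    rcases hr.eq_or_lt with h0 | h0
    · rw [← h0]; simp [Real.zero_rpow hp1.ne']
    · rw [mul_comm, ← Real.rpow_add_one h0.ne']; congr 1; ring
  have nv : ∀ t x, t ∈ S → x ∈ B → ‖v t x‖ = ‖w t x‖ ^ (p - 1) * c t := by
    intro t x ht hx
    have := hc0 t
    rw [hvS t x ht hx, norm_mul, RCLike.norm_conj, Complex.norm_real, Real.norm_of_nonneg (by positivity), ← mul_assoc, hpow _ (norm_nonneg _)]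
  have nvb : ∀ t x, ‖v t x‖ ≤ (Set.Icc (-R) R).indicator (fun _ => (1 : ℝ)) t * B.indicator (fun _ => M ^ (p - 1) * D) x := by
    intro t x
    by_cases htx : t ∈ S ∧ x ∈ B
    · have ht' : t ∈ Set.Icc (-R) R := by
        have := htx.1; rw [hS] at this; exact abs_le.1 this.1
      rw [nv t x htx.1 htx.2, Set.indicator_of_mem ht', Set.indicator_of_mem htx.2, one_mul]
      have := hc0 t
      gcongr
      · exact hM t x
      · exact hcD t htx.1
    · rw [hvS' t x htx, norm_zero]
      by_cases htx : t ∈ S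
      · have := (hc0 t).trans (hcD t htx)
        refine mul_nonneg (Set.indicator_nonneg (fun _ _ => zero_le_one) _) (Set.indicator_nonneg (fun _ _ => by positivity) _)
      · by_cases hD0 : 0 ≤ D
        · refine mul_nonneg (Set.indicator_nonneg (fun _ _ => zero_le_one) _) (Set.indicator_nonneg (fun _ _ => by positivity) _)
        · exfalso
          apply hD0
          rw [hD, hb]; positivity
  have hD0 : 0 ≤ D := by rw [hD, hb]; positivity
  have iB : Integrable (B.indicator (fun _ => M ^ (p - 1) * D)) := (integrable_indicator_iff mB).2 (integrableOn_const vB.ne)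
  have iI : Integrable ((Set.Icc (-R) R).indicator (fun _ => (1 : ℝ))) := (integrable_indicator_iff measurableSet_Icc).2 (integrableOn_const (by simp))
  have nice : Nice2 v := by
    refine ⟨mv, ⟨M ^ (p - 1) * D, fun s y => ?_⟩, fun s => ?_, ?_⟩
    · by_cases htx : s ∈ S ∧ y ∈ B
      · rw [nv s y htx.1 htx.2]
        have := hc0 s
        gcongr
        · exact hM s y
        · exact hcD s htx.1
      · rw [hvS' s y htx, norm_zero]; positivity
    · exact (iB.const_mul _).mono' (mv.comp measurable_prodMk_left).aestronglyMeasurable (Filter.Eventually.of_forall fun y => nvb s y)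
    · refine ⟨fun s => (Set.Icc (-R) R).indicator (fun _ => (1 : ℝ)) s * ∫ y, B.indicator (fun _ => M ^ (p - 1) * D) y, iI.mul_const _, fun s => ?_⟩
      dsimp only
      rw [← integral_const_mul]
      exact integral_mono_of_nonneg (Filter.Eventually.of_forall fun y => norm_nonneg _) (iB.const_mul _) (Filter.Eventually.of_forall fun y => nvb s y)
  have env : ∀ t x, t ∈ S → x ∈ B → ‖v t x‖ₑ = ‖w t x‖ₑ ^ (p - 1) * P t ^ ((q - p) / p) := by
    intro t x ht hx
    rw [← ofReal_norm, nv t x ht hx, ENNReal.ofReal_mul (by positivity), hcE t ht, ← ENNReal.ofReal_rpow_of_nonneg (norm_nonneg _) hp1.le, ofReal_norm]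
  have hPpos : ∀ t ∈ S, P t ≠ 0 := by
    intro t ht h0
    have := (hPr t ht).1
    rw [h0, ENNReal.toReal_zero] at this
    have : 0 < 1 / R := by positivity
    linarith
  -- the dual norm of the test function
  have hmn : mn (q / (q - 1)) (p / (p - 1)) v = (∫⁻ t, S.indicator (fun t => P t ^ (q / p)) t) ^ (1 / (q / (q - 1))) := by
    rw [mn]
    congr 2; ext t
    by_cases ht : t ∈ S
    · rw [Set.indicator_of_mem ht, sn]
      have : ∫⁻ x, ‖v t x‖ₑ ^ (p / (p - 1)) = P t * (P t ^ ((q - p) / p)) ^ (p / (p - 1)) := by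
        have e2 : P t = ∫⁻ x, B.indicator (fun x => ‖w t x‖ₑ ^ p) x := by
          rw [← hP' t, ← hB, ← lintegral_indicator mB]
        nth_rewrite 1 [e2]
        rw [← lintegral_mul_const' _ _ (by
          rw [← ENNReal.rpow_mul]
          exact (ENNReal.rpow_ne_top_of_ne_zero (hPpos t ht) (hPt t)))]
        congr 1; ext x
        by_cases hx : x ∈ B
        · rw [Set.indicator_of_mem hx, env t x ht hx, ENNReal.mul_rpow_of_nonneg _ _ (by positivity), ← ENNReal.rpow_mul ‖w t x‖ₑ,
            mul_div_cancel₀ _ hp1.ne']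
        · rw [Set.indicator_of_notMem hx, hvS' t x (by tauto)]
          simp; positivity
      rw [this, ← ENNReal.rpow_mul (P t)]
      nth_rewrite 1 [← ENNReal.rpow_one (P t)]
      rw [← ENNReal.rpow_add _ _ (hPpos t ht) (hPt t), ← ENNReal.rpow_mul, ← ENNReal.rpow_mul]
      congr 1
      field_simp
      ring
    · rw [Set.indicator_of_notMem ht, sn]
      have : ∀ x, v t x = 0 := fun x => hvS' t x (by tauto)
      simp_rw [this]
      simp [hp0, hp1, hq0, hq1]
  have hpair : ‖∫ t, ∫ x, w t x * v t x‖ₑ = ∫⁻ t, S.indicator (fun t => P t ^ (q / p)) t := by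
    have iwv : Integrable (fun z : ℝ × V => w z.1 z.2 * v z.1 z.2) := by
      refine (nice.int_prod.norm.const_mul M).mono' (hw.mul mv).aestronglyMeasurable (Filter.Eventually.of_forall fun z => ?_)
      rw [norm_mul]
      exact mul_le_mul_of_nonneg_right (hM _ _) (norm_nonneg _)
    rw [← integral_prod _ iwv]
    rw [← Measure.volume_eq_prod, enorm_int_of_pos iwv, Measure.volume_eq_prod, lintegral_prod (fun z : ℝ × V => ‖w z.1 z.2 * v z.1 z.2‖ₑ) (hw.mul mv).enorm.aemeasurable]
    · congr 1; ext t
      by_cases ht : t ∈ S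
      · rw [Set.indicator_of_mem ht]
        have e1 : P t ^ (q / p) = P t * P t ^ ((q - p) / p) := by
          nth_rewrite 2 [← ENNReal.rpow_one (P t)]
          rw [← ENNReal.rpow_add _ _ (hPpos t ht) (hPt t)]
          congr 1; field_simp; ring
        have e2 : P t = ∫⁻ x, B.indicator (fun x => ‖w t x‖ₑ ^ p) x := by
          rw [← hP' t, ← hB, ← lintegral_indicator mB]
        rw [e1]
        nth_rewrite 1 [e2]
        rw [← lintegral_mul_const' _ _ (ENNReal.rpow_ne_top_of_ne_zero (hPpos t ht) (hPt t))]
        congr 1; ext x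
        by_cases hx : x ∈ B
        · rw [Set.indicator_of_mem hx, enorm_mul, env t x ht hx, ← mul_assoc]
          congr 1
          nth_rewrite 1 [← ENNReal.rpow_one ‖w t x‖ₑ]
          rw [← ENNReal.rpow_add_of_nonneg _ _ (by norm_num) hp1.le]
          congr 1; ring
        · rw [Set.indicator_of_notMem hx, hvS' t x (by tauto)]
          simp
      · rw [Set.indicator_of_notMem ht]
        have : ∀ x, v t x = 0 := fun x => hvS' t x (by tauto)
        simp_rw [this]
        simp
    · rintro ⟨t, x⟩
      dsimp only
      by_cases htx : t ∈ S ∧ x ∈ B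
      · have := hc0 t
        rw [hvS t x htx.1 htx.2, ← mul_assoc, Complex.mul_conj, Complex.normSq_eq_norm_sq, ← Complex.ofReal_mul, Complex.norm_real, Real.norm_of_nonneg (by positivity)]
      · rw [hvS' t x htx]; simp
  have main := h v nice
  rw [hmn, hpair] at main
  obtain ⟨Q, hQ⟩ : ∃ Q, Q = ∫⁻ t, S.indicator (fun t => P t ^ (q / p)) t := ⟨_, rfl⟩
  rw [← hQ] at main ⊢
  have hQt : Q ≠ ⊤ := by
    have : Q ≤ ∫⁻ t, (Set.Icc (-R) R).indicator (fun _ => (ENNReal.ofReal M ^ p * volume B) ^ (q / p)) t := by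
      rw [hQ]
      refine lintegral_mono fun t => ?_
      by_cases ht : t ∈ S
      · have ht' : t ∈ Set.Icc (-R) R := by
          have := ht; rw [hS] at this; exact abs_le.1 this.1
        rw [Set.indicator_of_mem ht, Set.indicator_of_mem ht']
        exact ENNReal.rpow_le_rpow (hPb t) (by positivity)
      · rw [Set.indicator_of_notMem ht]; exact zero_le
    refine (this.trans_lt ?_).ne
    rw [lintegral_indicator measurableSet_Icc]
    simp only [lintegral_const]
    exact ENNReal.mul_lt_top (ENNReal.rpow_lt_top_of_nonneg (by positivity) hbt.ne) (by simp)
  by_cases hQ0 : Q = 0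
  · rw [hQ0]; exact zero_le
  have e1 : Q ^ (1 / q) ≤ C := by
    have : Q = Q ^ (1 / q) * Q ^ (1 / (q / (q - 1))) := by
      rw [← ENNReal.rpow_add _ _ hQ0 hQt]
      nth_rewrite 1 [← ENNReal.rpow_one Q]
      congr 1; field_simp; ring
    have main2 : Q ^ (1 / q) * Q ^ (1 / (q / (q - 1))) ≤ C * Q ^ (1 / (q / (q - 1))) := by
      rw [← this]; exact main
    refine (ENNReal.mul_le_mul_iff_left ?_ ?_).1 main2
    · simp [hQ0, hQt]
    · exact ENNReal.rpow_ne_top_of_ne_zero hQ0 hQt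
  calc Q = (Q ^ (1 / q)) ^ q := by rw [← ENNReal.rpow_mul, one_div_mul_cancel hq0.ne', ENNReal.rpow_one]
    _ ≤ _ := ENNReal.rpow_le_rpow e1 hq0.le

lemma conv_holder {p q : ℝ} (hp : 2 < p) (hq : 2 < q) {w : ℝ → V → ℂ} (hw : Measurable (Function.uncurry w)) {M : ℝ} (hM : ∀ t x, ‖w t x‖ ≤ M)
    {C : ℝ≥0∞} (h : ∀ v : ℝ → V → ℂ, Nice2 v → ‖∫ t, ∫ x, w t x * v t x‖ₑ ≤ C * mn (q / (q - 1)) (p / (p - 1)) v) :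
    mn q p w ≤ C := by
  have hp0 : 0 < p := by linarith
  have hq0 : 0 < q := by linarith
  suffices hs : ∫⁻ t, sn p (w t) ^ q ≤ C ^ q by
    have := ENNReal.rpow_le_rpow hs (z := 1 / q) (by positivity)
    rw [← ENNReal.rpow_mul C, mul_one_div_cancel hq0.ne', ENNReal.rpow_one] at this
    exact this
  obtain ⟨P, hP⟩ : ∃ P : ℕ → ℝ → ℝ≥0∞, P = fun (n : ℕ) (t : ℝ) => ∫⁻ x in Metric.closedBall (0 : V) ((n : ℝ) + 1), ‖w t x‖ₑ ^ p := ⟨_, rfl⟩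
  have mP : ∀ n, Measurable (P n) := by
    intro n
    rw [hP]
    exact Measurable.lintegral_prod_right' (f := fun z : ℝ × V => ‖w z.1 z.2‖ₑ ^ p) (hw.enorm.pow_const p)
  obtain ⟨S, hS⟩ : ∃ S : ℕ → Set ℝ, S = fun n : ℕ => {t : ℝ | |t| ≤ (n : ℝ) + 1 ∧ ENNReal.ofReal (1 / ((n : ℝ) + 1)) ≤ P n t} := ⟨_, rfl⟩
  have mS : ∀ n, MeasurableSet (S n) := by
    intro n
    rw [hS]
    exact (measurableSet_le (f := fun t : ℝ => |t|) (g := fun _ => (n : ℝ) + 1) (by fun_prop) (by fun_prop)).inter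
      (measurableSet_le measurable_const (mP n))
  have hb : ∀ n, ∫⁻ t, (S n).indicator (fun t => P n t ^ (q / p)) t ≤ C ^ q := by
    intro n
    have := conv_holder_trunc hp hq hw hM h (R := (n : ℝ) + 1) (by positivity)
    rw [hS, hP]; exact this
  have hl := lintegral_liminf_le (μ := (volume : Measure ℝ)) (u := Filter.atTop)
    (f := fun (n : ℕ) t => (S n).indicator (fun t => P n t ^ (q / p)) t)
    (fun n => ((mP n).pow_const _).indicator (mS n))
  have hlim : ∀ t, Filter.Tendsto (fun n => (S n).indicator (fun t => P n t ^ (q / p)) t) Filter.atTop (nhds (sn p (w t) ^ q)) := by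
    intro t
    have h1 : Filter.Tendsto (fun n => P n t) Filter.atTop (nhds (∫⁻ x, ‖w t x‖ₑ ^ p)) := by
      have e : ∀ n, P n t = ∫⁻ x, (Metric.closedBall (0 : V) ((n : ℝ) + 1)).indicator (fun x => ‖w t x‖ₑ ^ p) x := by
        intro n
        rw [lintegral_indicator Metric.isClosed_closedBall.measurableSet, hP]
      simp_rw [e]
      have hwt : Measurable (w t) := hw.comp measurable_prodMk_left
      refine lintegral_tendsto_of_tendsto_of_monotone ?_ ?_ ?_
      · intro n
        exact ((hwt.enorm.pow_const p).indicator Metric.isClosed_closedBall.measurableSet).aemeasurable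
      · refine Filter.Eventually.of_forall fun x => ?_
        intro m n hmn
        refine Set.indicator_le_indicator_of_subset (Metric.closedBall_subset_closedBall ?_) (fun _ => zero_le) _
        have : (m : ℝ) ≤ n := by exact_mod_cast hmn
        linarith
      · refine Filter.Eventually.of_forall fun x => ?_
        refine tendsto_const_nhds.congr' ?_
        obtain ⟨N, hN⟩ := exists_nat_ge ‖x‖
        filter_upwards [Filter.eventually_ge_atTop N] with n hn
        rw [Set.indicator_of_mem]
        rw [Metric.mem_closedBall, dist_zero_right]
        have : (N : ℝ) ≤ n := by exact_mod_cast hn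
        linarith
    have h2 : Filter.Tendsto (fun n => P n t ^ (q / p)) Filter.atTop (nhds (sn p (w t) ^ q)) := by
      have e : sn p (w t) ^ q = (∫⁻ x, ‖w t x‖ₑ ^ p) ^ (q / p) := by
        rw [sn, ← ENNReal.rpow_mul]; congr 1; field_simp
      rw [e]
      exact (ENNReal.continuous_rpow_const.tendsto _).comp h1
    by_cases h0 : ∫⁻ x, ‖w t x‖ₑ ^ p = 0
    · have e : sn p (w t) ^ q = 0 := by
        rw [sn, h0, ENNReal.zero_rpow_of_pos (by positivity), ENNReal.zero_rpow_of_pos hq0]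
      rw [e] at h2 ⊢
      refine tendsto_of_tendsto_of_tendsto_of_le_of_le tendsto_const_nhds h2 (fun n => zero_le) (fun n => ?_)
      exact Set.indicator_le_self' (fun _ _ => zero_le) t
    · refine h2.congr' ?_
      have h3 : Filter.Tendsto (fun n : ℕ => ENNReal.ofReal (1 / ((n : ℝ) + 1))) Filter.atTop (nhds 0) := by
        have := ENNReal.tendsto_ofReal (tendsto_one_div_add_atTop_nhds_zero_nat (𝕜 := ℝ))
        simpa using this
      obtain ⟨N, hN⟩ := exists_nat_ge |t|
      filter_upwards [h3.eventually_lt h1 (pos_iff_ne_zero.2 h0), Filter.eventually_ge_atTop N] with n hn hn2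
      rw [Set.indicator_of_mem]
      rw [hS]
      refine ⟨?_, hn.le⟩
      have : (N : ℝ) ≤ n := by exact_mod_cast hn2
      linarith
  have e : ∀ t, Filter.liminf (fun n => (S n).indicator (fun t => P n t ^ (q / p)) t) Filter.atTop = sn p (w t) ^ q :=
    fun t => (hlim t).liminf_eq
  simp_rw [e] at hl
  refine hl.trans ?_
  refine (Filter.liminf_le_liminf (v := fun _ => C ^ q) (Filter.Eventually.of_forall hb)).trans ?_
  simp

end Stz

namespace Stz

variable {V : Type*} [NormedAddCommGroup V] [InnerProductSpace ℝ V] [FiniteDimensional ℝ V]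
    [MeasurableSpace V] [BorelSpace V]

lemma sn_interp {p p₁ θ : ℝ} (hp : 2 < p) (hp1 : 2 < p₁) (h0 : 0 ≤ θ) (h1 : θ ≤ 1) (e : 1 / p = (1 - θ) / 2 + θ / p₁)
    {f : V → ℂ} (hf : Measurable f) : sn p f ≤ sn 2 f ^ (1 - θ) * sn p₁ f ^ θ := by
  have hp0 : 0 < p := by linarith
  have hp10 : 0 < p₁ := by linarith
  have hθ : 0 ≤ 1 - θ := by linarith
  have h := ENNReal.lintegral_mul_norm_pow_le (μ := (volume : Measure V)) (f := fun x => ‖f x‖ₑ ^ (2 : ℝ)) (g := fun x => ‖f x‖ₑ ^ p₁)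
    (by fun_prop) (by fun_prop) (p := (1 - θ) * p / 2) (q := θ * p / p₁) (by positivity) (by positivity)
    (by
      have : (1 - θ) * p / 2 + θ * p / p₁ = p * (1 / p) := by rw [e]; ring
      rw [this]; field_simp)
  have ee : ∀ x, (‖f x‖ₑ ^ (2 : ℝ)) ^ ((1 - θ) * p / 2) * (‖f x‖ₑ ^ p₁) ^ (θ * p / p₁) = ‖f x‖ₑ ^ p := by
    intro x
    have : 0 ≤ 1 - θ := by linarith
    rw [← ENNReal.rpow_mul, ← ENNReal.rpow_mul, ← ENNReal.rpow_add_of_nonneg _ _ (by positivity) (by positivity)]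
    congr 1; field_simp; ring
  simp_rw [ee] at h
  have h2 := ENNReal.rpow_le_rpow h (z := 1 / p) (by positivity)
  rw [ENNReal.mul_rpow_of_nonneg _ _ (by positivity)] at h2
  refine h2.trans (le_of_eq ?_)
  simp only [sn, ← ENNReal.rpow_mul]
  congr 2 <;> field_simp

lemma adm_theta {p₀ q₀ p₁ q₁ : ℝ} (h0 : Adm V p₀ q₀) (h1 : Adm V p₁ q₁) : 1 / p₀ = (1 - q₁ / q₀) / 2 + (q₁ / q₀) / p₁ := by
  have e0 := h0.e
  have e1 := h1.e
  have p0 : 0 < p₀ := by linarith [h0.hp]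
  have p1 : 0 < p₁ := by linarith [h1.hp]
  have c0 : 0 < q₀ := by linarith [h0.hq]
  have c1 : 0 < q₁ := by linarith [h1.hq]
  obtain ⟨n, hn⟩ : ∃ n : ℝ, n = (Module.finrank ℝ V : ℝ) := ⟨_, rfl⟩
  rw [← hn] at e0 e1
  have hn0 : n ≠ 0 := by
    rintro rfl
    simp at e0; linarith
  have f0 : n * (1 / 2 - 1 / p₀) * q₀ = 2 := by
    have : n * (1 / 2 - 1 / p₀) = 2 / q₀ := by rw [e0]; ring
    rw [this]; field_simp
  have f1 : n * (1 / 2 - 1 / p₁) * q₁ = 2 := by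
    have : n * (1 / 2 - 1 / p₁) = 2 / q₁ := by rw [e1]; ring
    rw [this]; field_simp
  have f2 : (1 / 2 - 1 / p₀) * q₀ = (1 / 2 - 1 / p₁) * q₁ := by
    apply mul_left_cancel₀ hn0; linarith
  have f3 : (1 / 2 - 1 / p₀) = (1 / 2 - 1 / p₁) * (q₁ / q₀) := by
    rw [← mul_div_assoc, ← f2]; field_simp
  linear_combination -f3

lemma case1 {p₀ q₀ p₁ q₁ : ℝ} (h0 : Adm V p₀ q₀) (h1 : Adm V p₁ q₁) (hle : q₁ ≤ q₀) : ∃ C : ℝ, 0 < C ∧ ∀ (ε : ℝ) (u : ℝ → V → ℂ), 0 < ε → Nice2 u →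
    mn q₀ p₀ (W ε u) ≤ ENNReal.ofReal C * mn (q₁ / (q₁ - 1)) (p₁ / (p₁ - 1)) u := by
  obtain ⟨A, hA, hA'⟩ := pairA h1
  obtain ⟨B, hB, hB'⟩ := pairB h1
  have p0 : 0 < p₀ := by linarith [h0.hp]
  have p1 : 0 < p₁ := by linarith [h1.hp]
  have c0 : 0 < q₀ := by linarith [h0.hq]
  have c1 : 0 < q₁ := by linarith [h1.hq]
  refine ⟨max A B, by positivity, fun ε u hε hu => ?_⟩
  obtain ⟨M, hM⟩ := W_bdd hε hu
  have mW := W_meas ε hu.meas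
  obtain ⟨N, hN⟩ : ∃ N, N = ENNReal.ofReal (max A B) * mn (q₁ / (q₁ - 1)) (p₁ / (p₁ - 1)) u := ⟨_, rfl⟩
  have hA2 : mn q₁ p₁ (W ε u) ≤ N := by
    rw [hN]
    refine (conv_holder h1.hp h1.hq mW hM fun v hv => hA' ε u v hε hu hv).trans ?_
    gcongr; exact le_max_left _ _
  have hB2 : ∀ t, sn 2 (W ε u t) ≤ N := fun t => by
    rw [hN]
    refine (hB' ε u hε hu t).trans ?_
    gcongr; exact le_max_right _ _
  rw [← hN]
  have hθ : q₁ / q₀ ≤ 1 := (div_le_one c0).2 hle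
  have hS : ∫⁻ t, sn p₁ (W ε u t) ^ q₁ ≤ N ^ q₁ := by
    have := ENNReal.rpow_le_rpow hA2 (z := q₁) c1.le
    rwa [mn, ← ENNReal.rpow_mul, one_div_mul_cancel c1.ne', ENNReal.rpow_one] at this
  have hd : 0 ≤ q₀ - q₁ := by linarith
  have key : ∫⁻ t, sn p₀ (W ε u t) ^ q₀ ≤ N ^ q₀ := by
    calc _ ≤ ∫⁻ t, N ^ (q₀ - q₁) * sn p₁ (W ε u t) ^ q₁ := by
          refine lintegral_mono fun t => ?_
          have := sn_interp h0.hp h1.hp (by positivity) hθ (adm_theta h0 h1) (f := W ε u t) (mW.comp measurable_prodMk_left)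
          refine (ENNReal.rpow_le_rpow this c0.le).trans ?_
          rw [ENNReal.mul_rpow_of_nonneg _ _ c0.le, ← ENNReal.rpow_mul, ← ENNReal.rpow_mul]
          rw [show (1 - q₁ / q₀) * q₀ = q₀ - q₁ by field_simp, show q₁ / q₀ * q₀ = q₁ by field_simp]
          exact mul_le_mul_left (ENNReal.rpow_le_rpow (hB2 t) hd) _
      _ = N ^ (q₀ - q₁) * ∫⁻ t, sn p₁ (W ε u t) ^ q₁ := lintegral_const_mul _ ((sn_meas mW _).pow_const _)
      _ ≤ N ^ (q₀ - q₁) * N ^ q₁ := mul_le_mul_right hS _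
      _ = N ^ q₀ := by
          rw [← ENNReal.rpow_add_of_nonneg _ _ hd c1.le]; congr 1; ring
  have := ENNReal.rpow_le_rpow key (z := 1 / q₀) (by positivity)
  rw [← ENNReal.rpow_mul N, mul_one_div_cancel c0.ne', ENNReal.rpow_one] at this
  exact this

lemma holder_x {p : ℝ} (hp : 2 < p) {f g : V → ℂ} (hf : Measurable f) (hg : Measurable g) :
    ‖∫ x, f x * g x‖ₑ ≤ sn p f * sn (p / (p - 1)) g := by
  refine (enorm_integral_le_lintegral_enorm _).trans ?_
  simp_rw [enorm_mul]
  exact ENNReal.lintegral_mul_le_Lp_mul_Lq volume (Real.HolderConjugate.conjExponent (by linarith)) hf.enorm.aemeasurable hg.enorm.aemeasurable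

lemma holder_tx {p q : ℝ} (hp : 2 < p) (hq : 2 < q) {w u : ℝ → V → ℂ} (hw : Measurable (Function.uncurry w)) (hu : Measurable (Function.uncurry u)) :
    ‖∫ t, ∫ x, w t x * u t x‖ₑ ≤ mn q p w * mn (q / (q - 1)) (p / (p - 1)) u := by
  refine (enorm_integral_le_lintegral_enorm _).trans ?_
  calc _ ≤ ∫⁻ t, sn p (w t) * sn (p / (p - 1)) (u t) := lintegral_mono fun t =>
        holder_x hp (hw.comp measurable_prodMk_left) (hu.comp measurable_prodMk_left)
    _ ≤ _ := ENNReal.lintegral_mul_le_Lp_mul_Lq volume (Real.HolderConjugate.conjExponent (by linarith)) (sn_meas hw _).aemeasurable (sn_meas hu _).aemeasurable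

/-- time reversal -/
def rv (u : ℝ → V → ℂ) : ℝ → V → ℂ := fun s => u (-s)

lemma rv_nice {u : ℝ → V → ℂ} (hu : Nice2 u) : Nice2 (rv u) := by
  obtain ⟨M, hM⟩ := hu.bdd
  obtain ⟨h, hi, hh⟩ := hu.l1
  refine ⟨?_, ⟨M, fun s y => hM _ _⟩, fun s => hu.slice _, ⟨fun s => h (-s), hi.comp_neg, fun s => hh _⟩⟩
  exact hu.meas.comp (f := fun z : ℝ × V => (-z.1, z.2)) (by fun_prop)

lemma rv_mn (q p : ℝ) (u : ℝ → V → ℂ) : mn q p (rv u) = mn q p u := by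
  unfold mn rv
  rw [lintegral_neg_eq_self (fun t => sn p (u t) ^ q)]

end Stz

namespace Stz

variable {V : Type*} [NormedAddCommGroup V] [InnerProductSpace ℝ V] [FiniteDimensional ℝ V]
    [MeasurableSpace V] [BorelSpace V]

lemma pair_expand {ε : ℝ} (hε : 0 < ε) {u v : ℝ → V → ℂ} (hu : Nice2 u) (hv : Nice2 v) :
    ∫ t, ∫ x, W ε u t x * v t x = ∫ t, ∫ s, ∫ x, Ue ε u t x s * v t x := by
  obtain ⟨g, gi, hg⟩ := hu.l1
  congr 1; ext t
  rw [← integral_integral_swap]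
  · congr 1; ext x
    rw [integral_mul_const]; rfl
  · refine int_prod_of_bound ?_ ((hv.slice t).norm) (gi.const_mul ((4 * π * ε) ^ (-((Module.finrank ℝ V : ℝ) / 2)))) ?_
    · refine Measurable.mul ?_ ?_
      · exact (Ue_meas ε hu.meas).comp (f := fun z : V × ℝ => ((t, z.1), z.2)) (by fun_prop)
      · exact hv.meas.comp (f := fun z : V × ℝ => (t, z.1)) (by fun_prop)
    · intro x s
      rw [norm_mul, mul_comm]
      exact mul_le_mul_of_nonneg_left (Ue_bd hε hu hg t x s) (norm_nonneg _)

lemma Tk_symm {a : ℝ} (ha : 0 < a) {f g : V → ℂ} (hf : Nice f) (hg : Nice g) : ∫ x, Tk a f x * g x = ∫ x, Tk a g x * f x := by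
  unfold Tk
  simp_rw [← integral_mul_const]
  rw [integral_integral_swap]
  · congr 1; ext x; congr 1; ext y
    rw [← K_neg a, neg_sub]; ring
  · refine int_prod_of_bound ?_ (hg.int.norm) (hf.int.norm.const_mul ((4 * π * a) ^ (-((Module.finrank ℝ V : ℝ) / 2)))) ?_
    · refine Measurable.mul (Measurable.mul ?_ ?_) ?_
      · exact K_meas.comp (f := fun z : V × V => (a, z.1 - z.2)) (by fun_prop)
      · exact hf.meas.comp measurable_snd
      · exact hg.meas.comp measurable_fst
    · intro x y
      rw [norm_mul, norm_mul, norm_K ha, mul_comm]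

lemma pair_symm {ε : ℝ} (hε : 0 < ε) {u v : ℝ → V → ℂ} (hu : Nice2 u) (hv : Nice2 v) :
    ∫ t, ∫ x, W ε u t x * v t x = ∫ t, ∫ x, W ε (rv v) t x * rv u t x := by
  rw [pair_expand hε hu hv, pair_expand hε (rv_nice hv) (rv_nice hu)]
  have e : ∀ t s, ∫ x, Ue ε (rv v) t x s * rv u t x = ∫ x, Ue ε u (-s) x (-t) * v (-s) x := by
    intro t s
    unfold Ue rv
    rw [show -s - -t = t - s by ring]
    split_ifs with h
    · exact Tk_symm (hε.trans h) (hv.nice _) (hu.nice _)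
    · simp
  simp_rw [e]
  rw [integral_neg_eq_self (fun t => ∫ s, ∫ x, Ue ε u (-s) x t * v (-s) x)]
  have e2 : ∀ t, ∫ s, ∫ x, Ue ε u (-s) x t * v (-s) x = ∫ s, ∫ x, Ue ε u s x t * v s x := fun t =>
    integral_neg_eq_self (fun s => ∫ x, Ue ε u s x t * v s x) volume
  simp_rw [e2]
  obtain ⟨g, gi, hg⟩ := hu.l1
  obtain ⟨k, ki, hk⟩ := hv.l1
  refine integral_integral_swap ?_
  refine int_prod_of_bound ?_ ki (gi.const_mul ((4 * π * ε) ^ (-((Module.finrank ℝ V : ℝ) / 2)))) ?_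
  · refine meas_int (X := ℝ × ℝ) (U := fun z x => Ue ε u z.1 x z.2 * v z.1 x) ?_
    refine Measurable.mul ?_ ?_
    · exact (Ue_meas ε hu.meas).comp (f := fun z : (ℝ × ℝ) × V => ((z.1.1, z.2), z.1.2)) (by fun_prop)
    · exact hv.meas.comp (f := fun z : (ℝ × ℝ) × V => (z.1.1, z.2)) (by fun_prop)
  · intro t s
    have hb := Ue_bd hε hu hg t (V := V)
    have h0 : 0 ≤ (4 * π * ε) ^ (-((Module.finrank ℝ V : ℝ) / 2)) * g s := (norm_nonneg _).trans (hb 0 s)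
    calc _ ≤ ∫ x, (4 * π * ε) ^ (-((Module.finrank ℝ V : ℝ) / 2)) * g s * ‖v t x‖ := by
          refine norm_integral_le_of_norm_le ((hv.slice t).norm.const_mul _) (Filter.Eventually.of_forall fun x => ?_)
          rw [norm_mul]
          exact mul_le_mul_of_nonneg_right (hb x s) (norm_nonneg _)
      _ = (4 * π * ε) ^ (-((Module.finrank ℝ V : ℝ) / 2)) * g s * ∫ x, ‖v t x‖ := integral_const_mul _ _
      _ ≤ (4 * π * ε) ^ (-((Module.finrank ℝ V : ℝ) / 2)) * g s * k t := mul_le_mul_of_nonneg_left (hk t) h0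
      _ = _ := mul_comm _ _

lemma trunc_main {p₀ q₀ p₁ q₁ : ℝ} (h0 : Adm V p₀ q₀) (h1 : Adm V p₁ q₁) : ∃ C : ℝ, 0 < C ∧ ∀ (ε : ℝ) (u : ℝ → V → ℂ), 0 < ε → Nice2 u →
    mn q₀ p₀ (W ε u) ≤ ENNReal.ofReal C * mn (q₁ / (q₁ - 1)) (p₁ / (p₁ - 1)) u := by
  rcases le_total q₁ q₀ with hle | hle
  · exact case1 h0 h1 hle
  obtain ⟨C, hC, h⟩ := case1 h1 h0 hle
  refine ⟨C, hC, fun ε u hε hu => ?_⟩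
  obtain ⟨M, hM⟩ := W_bdd hε hu
  refine conv_holder h0.hp h0.hq (W_meas ε hu.meas) hM fun v hv => ?_
  rw [pair_symm hε hu hv]
  refine (holder_tx h1.hp h1.hq (W_meas ε (rv_nice hv).meas) (rv_nice hu).meas).trans ?_
  rw [rv_mn]
  refine (mul_le_mul_left (h ε (rv v) hε (rv_nice hv)) _).trans (le_of_eq ?_)
  rw [rv_mn]; ring

end Stz

namespace Stz

lemma adm_of {d : ℕ} (hd : 1 ≤ d) {p q : ℝ} (hq : 2 ≤ q) (h : IsAdmissible d p q) : Adm (EuclideanSpace ℝ (Fin d)) p q := by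
  obtain ⟨e, hp, h3⟩ := h
  have hq0 : 0 < q := by linarith
  have hp0 : 0 < p := by linarith
  have hd0 : (1 : ℝ) ≤ d := by exact_mod_cast hd
  have e2 : 0 < 2 / q := by positivity
  have hf : Module.finrank ℝ (EuclideanSpace ℝ (Fin d)) = d := finrank_euclideanSpace_fin
  refine ⟨?_, ?_, by rw [hf]; exact e⟩
  · refine lt_of_le_of_ne hp ?_
    rintro rfl
    rw [e] at e2; simp at e2
  · refine lt_of_le_of_ne hq ?_
    rintro rfl
    have e3 : (d : ℝ) / p = d / 2 - 1 := by linarith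
    have e4 : 0 < (d : ℝ) / p := by positivity
    have hd2 : (2 : ℝ) < d := by linarith
    have hd3 : 3 ≤ d := by exact_mod_cast hd2
    have h5 := h3 hd3
    rw [lt_div_iff₀ (by linarith)] at h5
    have : (d : ℝ) = (d / 2 - 1) * p := by rw [← e3]; field_simp
    nlinarith

variable {d : ℕ}


/-- cut-off in time -/
noncomputable def cut (T : ℝ) (u : ℝ → SchwartzMap (EuclideanSpace ℝ (Fin d)) ℂ) (s : ℝ) (y : EuclideanSpace ℝ (Fin d)) : ℂ :=
  if s ∈ Set.Icc 0 T then u s y else 0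

lemma cut_nice {T : ℝ} {u : ℝ → SchwartzMap (EuclideanSpace ℝ (Fin d)) ℂ} (hu : ContinuousOn u (Set.Icc 0 T)) : Nice2 (cut T u) := by
  have hF : ContinuousOn (fun s => SchwartzMap.toBoundedContinuousFunctionCLM ℂ (EuclideanSpace ℝ (Fin d)) ℂ (u s)) (Set.Icc 0 T) :=
    (SchwartzMap.toBoundedContinuousFunctionCLM ℂ (EuclideanSpace ℝ (Fin d)) ℂ).continuous.comp_continuousOn hu
  have hG : ContinuousOn (fun s => SchwartzMap.toLpCLM ℂ ℂ 1 volume (u s)) (Set.Icc 0 T) :=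
    (SchwartzMap.toLpCLM ℂ ℂ 1 (volume : Measure (EuclideanSpace ℝ (Fin d)))).continuous.comp_continuousOn hu
  obtain ⟨A, hA⟩ := isCompact_Icc.exists_bound_of_continuousOn hF
  obtain ⟨B, hB⟩ := isCompact_Icc.exists_bound_of_continuousOn hG
  refine ⟨?_, ⟨max A 0, ?_⟩, ?_, ⟨(Set.Icc 0 T).indicator fun _ => B, ?_, ?_⟩⟩
  · have hc : ContinuousOn (fun z : ℝ × EuclideanSpace ℝ (Fin d) => u z.1 z.2) (Set.Icc 0 T ×ˢ Set.univ) := by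
      have h1 : ContinuousOn (fun z : ℝ × EuclideanSpace ℝ (Fin d) => (SchwartzMap.toBoundedContinuousFunctionCLM ℂ (EuclideanSpace ℝ (Fin d)) ℂ (u z.1), z.2)) (Set.Icc 0 T ×ˢ Set.univ) :=
        (hF.comp continuous_fst.continuousOn (fun z hz => hz.1)).prodMk continuous_snd.continuousOn
      exact (ContinuousEval.continuous_eval (F := BoundedContinuousFunction (EuclideanSpace ℝ (Fin d)) ℂ)).comp_continuousOn h1
    have hm : MeasurableSet (Set.Icc (0 : ℝ) T ×ˢ (Set.univ : Set (EuclideanSpace ℝ (Fin d)))) := measurableSet_Icc.prod MeasurableSet.univ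
    classical
    have := hc.measurable_piecewise (g := fun _ => 0) continuousOn_const hm
    convert this using 1
    ext ⟨s, y⟩
    simp [cut, Set.piecewise, Function.uncurry]
  · intro s y
    unfold cut
    split_ifs with h
    · refine le_trans ?_ ((hA s h).trans (le_max_left _ _))
      exact (SchwartzMap.toBoundedContinuousFunctionCLM ℂ (EuclideanSpace ℝ (Fin d)) ℂ (u s)).norm_coe_le_norm y
    · simp
  · intro s
    unfold cut
    split_ifs with h
    · exact (u s).integrable
    · simp
  · exact (integrableOn_const (by simp)).integrable_indicator measurableSet_Icc
  · intro s
    by_cases h : s ∈ Set.Icc 0 T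
    · rw [Set.indicator_of_mem h]
      refine le_trans (le_of_eq ?_) (hB s h)
      rw [SchwartzMap.toLpCLM_apply, SchwartzMap.norm_toLp_one]
      simp only [cut, if_pos h]
    · rw [Set.indicator_of_notMem h]
      simp [cut, h]

lemma prop_eq {a : ℝ} (ha : a ≠ 0) (f : EuclideanSpace ℝ (Fin d) → ℂ) (x : EuclideanSpace ℝ (Fin d)) : schrodingerProp d a f x = Tk a f x := by
  unfold schrodingerProp Tk K
  rw [if_neg ha, ← integral_const_mul, finrank_euclideanSpace_fin]
  congr 1; ext y; ring

lemma Ue_cut {T ε t : ℝ} (hε : 0 < ε) (ht : t ≤ T) (u : ℝ → SchwartzMap (EuclideanSpace ℝ (Fin d)) ℂ) (x : EuclideanSpace ℝ (Fin d)) (s : ℝ) :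
    Ue ε (cut T u) t x s = (Set.Ico 0 (t - ε)).indicator (fun s => schrodingerProp d (t - s) (u s) x) s := by
  unfold Ue
  by_cases h1 : ε < t - s
  · rw [if_pos h1]
    by_cases h2 : 0 ≤ s
    · have hs : s ∈ Set.Ico 0 (t - ε) := ⟨h2, by linarith⟩
      have hs2 : s ∈ Set.Icc 0 T := ⟨h2, by linarith⟩
      rw [Set.indicator_of_mem hs, prop_eq (by linarith)]
      congr 1; ext y; simp only [cut, if_pos hs2]
    · rw [Set.indicator_of_notMem (fun h => h2 h.1)]
      have : ¬ s ∈ Set.Icc 0 T := fun h => h2 h.1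
      simp [Tk, cut, this]
  · rw [if_neg h1, Set.indicator_of_notMem]
    intro h; apply h1; linarith [h.2]

lemma conv_liminf {T t r : ℝ} (hr : 0 < r) (ht0 : 0 < t) (ht : t ≤ T) (u : ℝ → SchwartzMap (EuclideanSpace ℝ (Fin d)) ℂ) (x : EuclideanSpace ℝ (Fin d)) :
    ‖schrodConv d (fun s => ⇑(u s)) t x‖ₑ ^ r ≤ Filter.liminf (fun n : ℕ => ‖W (1 / ((n : ℝ) + 1)) (cut T u) t x‖ₑ ^ r) Filter.atTop := by
  obtain ⟨g, hg⟩ : ∃ g : ℝ → ℂ, g = fun s => schrodingerProp d (t - s) (u s) x := ⟨_, rfl⟩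
  have e1 : schrodConv d (fun s => ⇑(u s)) t x = ∫ s in Set.Ioc 0 t, g s := by
    rw [schrodConv, intervalIntegral.integral_of_le ht0.le, hg]
  by_cases hi : IntegrableOn g (Set.Ioc 0 t)
  swap
  · rw [e1, integral_undef hi]
    simp [hr]
  have hi2 : IntegrableOn g (Set.Ico 0 t) := hi.congr_set_ae Ico_ae_eq_Ioc
  have e2 : schrodConv d (fun s => ⇑(u s)) t x = ∫ s, (Set.Ico 0 t).indicator g s := by
    rw [e1, integral_indicator measurableSet_Ico]
    exact setIntegral_congr_set Ico_ae_eq_Ioc.symm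
  have hε : ∀ n : ℕ, 0 < 1 / ((n : ℝ) + 1) := fun n => by positivity
  have e3 : ∀ n : ℕ, W (1 / ((n : ℝ) + 1)) (cut T u) t x = ∫ s, (Set.Ico 0 (t - 1 / ((n : ℝ) + 1))).indicator g s := by
    intro n
    rw [W, hg]; congr 1; ext s
    exact Ue_cut (hε n) ht u x s
  have hsub : ∀ n : ℕ, Set.Ico 0 (t - 1 / ((n : ℝ) + 1)) ⊆ Set.Ico 0 t := fun n => Set.Ico_subset_Ico_right (by linarith [hε n])
  have hlim : Filter.Tendsto (fun n : ℕ => W (1 / ((n : ℝ) + 1)) (cut T u) t x) Filter.atTop (nhds (schrodConv d (fun s => ⇑(u s)) t x)) := by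
    simp_rw [e3]
    rw [e2]
    refine tendsto_integral_of_dominated_convergence (fun s => ‖(Set.Ico 0 t).indicator g s‖) ?_ ?_ ?_ ?_
    · intro n
      exact ((hi2.mono_set (hsub n)).integrable_indicator measurableSet_Ico).aestronglyMeasurable
    · exact (hi2.integrable_indicator measurableSet_Ico).norm
    · intro n
      refine Filter.Eventually.of_forall fun s => ?_
      exact norm_indicator_le_of_subset (hsub n) g s
    · refine Filter.Eventually.of_forall fun s => ?_
      refine tendsto_const_nhds.congr' ?_
      by_cases hs : s ∈ Set.Ico 0 t
      · have h3 := (tendsto_one_div_add_atTop_nhds_zero_nat (𝕜 := ℝ)).eventually_lt_const (sub_pos.2 hs.2)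
        filter_upwards [h3] with n hn
        rw [Set.indicator_of_mem hs, Set.indicator_of_mem]
        exact ⟨hs.1, by linarith⟩
      · filter_upwards with n
        rw [Set.indicator_of_notMem hs, Set.indicator_of_notMem (fun h => hs (hsub n h))]
  have := (ENNReal.continuous_rpow_const (y := r)).tendsto _ |>.comp ((continuous_enorm.tendsto _).comp hlim)
  exact this.liminf_eq.ge

lemma eLp_eq {r : ℝ} (hr : 0 < r) (f : EuclideanSpace ℝ (Fin d) → ℂ) : eLpNorm f (ENNReal.ofReal r) volume = sn r f := by
  rw [eLpNorm_eq_lintegral_rpow_enorm_toReal (by simpa using hr) ENNReal.ofReal_ne_top, ENNReal.toReal_ofReal hr.le]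
  rfl

lemma mixed_cut {q r T : ℝ} (hq : 0 < q) (hr : 0 < r) (u : ℝ → SchwartzMap (EuclideanSpace ℝ (Fin d)) ℂ) :
    mn q r (cut T u) = mixedNorm d q r T (fun s => ⇑(u s)) := by
  unfold mn mixedNorm
  congr 1
  rw [setLIntegral_congr Ioc_ae_eq_Icc, ← lintegral_indicator measurableSet_Icc]
  congr 1; ext t
  by_cases ht : t ∈ Set.Icc 0 T
  · rw [Set.indicator_of_mem ht, eLp_eq hr]
    congr 2; ext y; simp only [cut, if_pos ht]
  · rw [Set.indicator_of_notMem ht]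
    simp [sn, cut, ht, hr, hq]

lemma fatou_mixed {q p T : ℝ} (hq : 0 < q) (hp : 0 < p) {u : ℝ → SchwartzMap (EuclideanSpace ℝ (Fin d)) ℂ} (hu : ContinuousOn u (Set.Icc 0 T)) {N : ℝ≥0∞}
    (hN : ∀ ε, 0 < ε → mn q p (W ε (cut T u)) ≤ N) : mixedNorm d q p T (schrodConv d (fun s => ⇑(u s))) ≤ N := by
  have hnice := cut_nice hu
  have mW : ∀ n : ℕ, Measurable (Function.uncurry (W (1 / ((n : ℝ) + 1)) (cut T u))) := fun n => W_meas _ hnice.meas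
  have h1 : ∀ t ∈ Set.Ioc 0 T, eLpNorm (schrodConv d (fun s => ⇑(u s)) t) (ENNReal.ofReal p) volume ^ q ≤
      Filter.liminf (fun n : ℕ => sn p (W (1 / ((n : ℝ) + 1)) (cut T u) t) ^ q) Filter.atTop := by
    intro t ht
    rw [eLp_eq hp]
    have h2 : ∫⁻ x, ‖schrodConv d (fun s => ⇑(u s)) t x‖ₑ ^ p ≤ Filter.liminf (fun n : ℕ => ∫⁻ x, ‖W (1 / ((n : ℝ) + 1)) (cut T u) t x‖ₑ ^ p) Filter.atTop := by
      refine (lintegral_mono fun x => conv_liminf hp ht.1 ht.2 u x).trans ?_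
      exact lintegral_liminf_le fun n => (((mW n).comp measurable_prodMk_left).enorm.pow_const p)
    have hqp : 0 < q / p := by positivity
    have e : ∀ f : EuclideanSpace ℝ (Fin d) → ℂ, sn p f ^ q = (∫⁻ x, ‖f x‖ₑ ^ p) ^ (q / p) := fun f => by
      rw [sn, ← ENNReal.rpow_mul]; congr 1; field_simp
    simp_rw [e]
    refine (ENNReal.rpow_le_rpow h2 hqp.le).trans (le_of_eq ?_)
    exact (ENNReal.orderIsoRpow (q / p) hqp).liminf_apply
  have h3 : ∫⁻ t in Set.Ioc 0 T, eLpNorm (schrodConv d (fun s => ⇑(u s)) t) (ENNReal.ofReal p) volume ^ q ≤ N ^ q := by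
    refine (setLIntegral_mono' measurableSet_Ioc h1).trans ?_
    refine (setLIntegral_le_lintegral _ _).trans ?_
    refine (lintegral_liminf_le fun n => (sn_meas (mW n) p).pow_const q).trans ?_
    refine (Filter.liminf_le_liminf (v := fun _ => N ^ q) (Filter.Eventually.of_forall fun n => ?_)).trans (by simp)
    have := ENNReal.rpow_le_rpow (hN (1 / ((n : ℝ) + 1)) (by positivity)) hq.le
    rwa [mn, ← ENNReal.rpow_mul, one_div_mul_cancel hq.ne', ENNReal.rpow_one] at this
  have := ENNReal.rpow_le_rpow h3 (z := 1 / q) (by positivity)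
  rw [← ENNReal.rpow_mul N, mul_one_div_cancel hq.ne', ENNReal.rpow_one] at this
  exact this

end Stz

/-- Strichartz estimate for the inhomogeneous term: for admissible pairs
`(p₀,q₀)` and `(p₁,q₁)`, `‖𝔗u‖_{L^{q₀}(0,T;L^{p₀})} ≤ C ‖u‖_{L^{q₁'}(0,T;L^{p₁'})}`. -/
theorem strichartz_inhomogeneous (d : ℕ) (hd : 1 ≤ d) (p₀ q₀ p₁ q₁ : ℝ)
    (hp₀ : 2 ≤ p₀) (hq₀ : 2 ≤ q₀) (hp₁ : 2 ≤ p₁) (hq₁ : 2 ≤ q₁)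
    (h₀ : IsAdmissible d p₀ q₀) (h₁ : IsAdmissible d p₁ q₁) (T : ℝ) (hT : 0 < T) :
    ∃ C : ℝ, 0 < C ∧
      ∀ u : ℝ → SchwartzMap (EuclideanSpace ℝ (Fin d)) ℂ,
        ContinuousOn u (Set.Icc 0 T) →
          mixedNorm d q₀ p₀ T (schrodConv d (fun s => ⇑(u s))) ≤
            ENNReal.ofReal C *
              mixedNorm d (q₁ / (q₁ - 1)) (p₁ / (p₁ - 1)) T (fun s => ⇑(u s)) := by
  obtain ⟨C, hC, h⟩ := Stz.trunc_main (Stz.adm_of hd hq₀ h₀) (Stz.adm_of hd hq₁ h₁)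
  refine ⟨C, hC, fun u hu => ?_⟩
  rw [← Stz.mixed_cut (div_pos (by linarith) (by linarith)) (div_pos (by linarith) (by linarith))]
  exact Stz.fatou_mixed (by linarith) (by linarith) hu fun ε hε => h ε _ hε (Stz.cut_nice hu)
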